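/- Let c < -1 be a constant and let f : [1, ∞) → ℝ be a differentiable function satisfying f(x) = O(x^c) and f'(x) = O(x^{c-1}) for x ≥ 1. Then for every constant A > 0 there is a constant such that for all 3/2 < y ≤ x, Σ_{y < p ≤ x, p prime} f(p) = ∫_y^x f(t)/log t dt + O(y^{c+1}/(log y)^A). -/

import Mathlib

open Filter Finset

/-- The Mellin transform of `u ↦ max (1 - u) 0`. -/
noncomputable def rieszKernel (s : ℂ) : ℂ := 1 / s - 1 / (s + 1)

lemma rieszKernel_eq {s : ℂ} (hs : 0 < s.re) : rieszKernel s = 1 / (s * (s + 1)) := by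
  have h1 : s ≠ 0 := by rintro rfl; simp at hs
  have h2 : s + 1 ≠ 0 := by
    intro h
    have := congrArg Complex.re h
    simp at this
    linarith
  unfold rieszKernel
  field_simp
  ring

lemma norm_rieszKernel_le {σ : ℝ} (hσ : 1 ≤ σ) (t : ℝ) :
    ‖rieszKernel (σ + t * Complex.I)‖ ≤ (1 + t ^ 2)⁻¹ := by
  rw [rieszKernel_eq (by simp; linarith), norm_div, norm_one, one_div, norm_mul]
  have h : ∀ r : ℝ, 1 ≤ r → √(1 + t ^ 2) ≤ ‖(r : ℂ) + t * Complex.I‖ := by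
    intro r hr
    rw [Complex.norm_add_mul_I]
    exact Real.sqrt_le_sqrt (by nlinarith)
  have h1 := h σ hσ
  have h2 := h (σ + 1) (by linarith)
  have e : ((σ + 1 : ℝ) : ℂ) + t * Complex.I = σ + t * Complex.I + 1 := by push_cast; ring
  rw [e] at h2
  have h0 : 0 < 1 + t ^ 2 := by positivity
  apply inv_anti₀ h0
  calc 1 + t ^ 2 = √(1 + t ^ 2) * √(1 + t ^ 2) := (Real.mul_self_sqrt h0.le).symm
    _ ≤ _ := by gcongr

lemma continuous_rieszKernel {σ : ℝ} (hσ : 1 ≤ σ) :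
    Continuous fun t : ℝ => rieszKernel (σ + t * Complex.I) := by
  have h : ∀ r : ℝ, 1 ≤ r → ∀ t : ℝ, (r : ℂ) + t * Complex.I ≠ 0 := by
    intro r hr t h
    have := congrArg Complex.re h
    simp at this
    linarith
  unfold rieszKernel
  refine Continuous.sub (continuous_const.div (by fun_prop) (h σ hσ))
    (continuous_const.div (by fun_prop) fun t => ?_)
  have := h (σ + 1) (by linarith) t
  intro h
  apply this
  rw [← h]
  push_cast
  ring

lemma integrable_rieszKernel {σ : ℝ} (hσ : 1 ≤ σ) :
    MeasureTheory.Integrable fun t : ℝ => rieszKernel (σ + t * Complex.I) :=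
  integrable_inv_one_add_sq.mono' (continuous_rieszKernel hσ).aestronglyMeasurable
    (Eventually.of_forall fun t => norm_rieszKernel_le hσ t)

lemma hasMellin_rieszMean {s : ℂ} (hs : 0 < s.re) :
    HasMellin (fun u : ℝ => ((max (1 - u) 0 : ℝ) : ℂ)) s (rieszKernel s) := by
  have h2 := hasMellin_cpow_Ioc 1 (s := s) (by simp; linarith)
  have h := hasMellin_sub (hasMellin_one_Ioc hs).1 h2.1
  rw [(hasMellin_one_Ioc hs).2, h2.2] at h
  have e : ∀ u ∈ Set.Ioi (0 : ℝ), (Set.Ioc (0 : ℝ) 1).indicator (fun _ => (1 : ℂ)) u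
      - (Set.Ioc (0 : ℝ) 1).indicator (fun t : ℝ => (t : ℂ) ^ (1 : ℂ)) u
      = ((max (1 - u) 0 : ℝ) : ℂ) := by
    intro u hu
    by_cases h1 : u ≤ 1
    · have : u ∈ Set.Ioc (0 : ℝ) 1 := ⟨hu, h1⟩
      rw [Set.indicator_of_mem this, Set.indicator_of_mem this, max_eq_left (by linarith)]
      simp
    · have : u ∉ Set.Ioc (0 : ℝ) 1 := fun h => h1 h.2
      rw [Set.indicator_of_notMem this, Set.indicator_of_notMem this,
        max_eq_right (by linarith)]
      simp
  constructor
  · exact (MeasureTheory.integrableOn_congr_fun (fun u hu => by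
      simp only [e u hu]) measurableSet_Ioi).1 h.1
  · rw [rieszKernel, ← h.2]
    exact MeasureTheory.setIntegral_congr_fun measurableSet_Ioi fun u hu => by
      simp only [e u hu]

lemma integral_cpow_mul_rieszKernel {σ u : ℝ} (hσ : 1 ≤ σ) (hu : 0 < u) :
    ∫ t : ℝ, (u : ℂ) ^ (-((σ : ℂ) + t * Complex.I)) * rieszKernel (σ + t * Complex.I)
      = 2 * Real.pi * ((max (1 - u) 0 : ℝ) : ℂ) := by
  have hre : ∀ t : ℝ, 0 < ((σ : ℂ) + t * Complex.I).re := by intro t; simp; linarith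
  have e : ∀ t : ℝ, mellin (fun u : ℝ => ((max (1 - u) 0 : ℝ) : ℂ)) (σ + t * Complex.I)
      = rieszKernel (σ + t * Complex.I) := fun t => (hasMellin_rieszMean (hre t)).2
  have h := mellinInv_mellin_eq σ (fun u : ℝ => ((max (1 - u) 0 : ℝ) : ℂ)) hu
    (hasMellin_rieszMean (by simp; linarith)).1
    (by
      unfold Complex.VerticalIntegrable
      simp only [e]
      exact integrable_rieszKernel hσ)
    (by fun_prop)
  unfold mellinInv at h
  simp only [e, smul_eq_mul] at h
  rw [← h, Complex.real_smul]
  generalize (∫ t : ℝ, (u : ℂ) ^ (-((σ : ℂ) + t * Complex.I)) *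
    rieszKernel (σ + t * Complex.I)) = J
  have : (Real.pi : ℂ) ≠ 0 := by exact_mod_cast Real.pi_ne_zero
  push_cast
  field_simp

lemma integrable_one_add_sq_rpow :
    MeasureTheory.Integrable fun t : ℝ => (1 + t ^ 2) ^ (-(3 / 4) : ℝ) := by
  have := integrable_rpow_neg_one_add_norm_sq (E := ℝ) (μ := MeasureTheory.volume)
    (r := 3 / 2) (by norm_num)
  convert this using 3
  · simp
  · norm_num

/-- The Riesz mean of the coefficients of a Dirichlet series is controlled by the size of the
series on a vertical line. -/
lemma norm_rieszMean_le {a : ℕ → ℂ} {σ X C : ℝ} (hσ : 1 ≤ σ) (hX : 0 < X)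
    (ha : LSeriesSummable a σ)
    (hC : ∀ t : ℝ, ‖LSeries a (σ + t * Complex.I)‖ ≤ C * (1 + t ^ 2) ^ (1 / 4 : ℝ)) :
    ‖∑ n ∈ Ioc 0 ⌊X⌋₊, a n * ((1 - n / X : ℝ) : ℂ)‖
      ≤ C * X ^ σ * ∫ t : ℝ, (1 + t ^ 2) ^ (-(3 / 4) : ℝ) := by
  set K : ℝ → ℂ := fun t => rieszKernel (σ + t * Complex.I) with hK
  set g : ℕ → ℝ → ℂ := fun n t =>
    LSeries.term a (σ + t * Complex.I) n * ((X : ℂ) ^ ((σ : ℂ) + t * Complex.I) * K t) with hg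
  have hX' : (X : ℂ) ≠ 0 := by exact_mod_cast hX.ne'
  have hXn : ∀ t : ℝ, ‖(X : ℂ) ^ ((σ : ℂ) + t * Complex.I)‖ = X ^ σ := by
    intro t
    rw [Complex.norm_cpow_eq_rpow_re_of_pos hX]
    simp
  have hgn : ∀ n t, ‖g n t‖ = ‖LSeries.term a σ n‖ * X ^ σ * ‖K t‖ := by
    intro n t
    simp only [hg, norm_mul, hXn, mul_assoc]
    congr 1
    rw [LSeries.norm_term_eq, LSeries.norm_term_eq]
    simp
  have hgcont : ∀ n, Continuous (g n) := by
    intro n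
    refine Continuous.mul ?_ (Continuous.mul ?_ (continuous_rieszKernel hσ))
    · rcases eq_or_ne n 0 with rfl | hn
      · simp only [LSeries.term_zero]; exact continuous_const
      · simp only [LSeries.term_of_ne_zero hn]
        have hn' : (n : ℂ) ≠ 0 := by exact_mod_cast hn
        refine continuous_const.div ?_ fun t => by simp [Complex.cpow_eq_zero_iff, hn']
        exact Continuous.const_cpow (by fun_prop) (Or.inl hn')
    · exact Continuous.const_cpow (by fun_prop) (Or.inl hX')
  have hgi : ∀ n, MeasureTheory.Integrable (g n) := fun n =>
    (((integrable_rieszKernel hσ).norm).const_mul (‖LSeries.term a σ n‖ * X ^ σ)).mono'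
      (hgcont n).aestronglyMeasurable (Eventually.of_forall fun t => (hgn n t).le)
  have hsum : Summable fun n => ∫ t, ‖g n t‖ := by
    simp only [hgn, MeasureTheory.integral_const_mul]
    exact ((ha.norm).mul_right _).mul_right _
  have hval : ∀ n, ∫ t, g n t
      = if n ∈ Ioc 0 ⌊X⌋₊ then 2 * Real.pi * (a n * ((1 - n / X : ℝ) : ℂ)) else 0 := by
    intro n
    rcases eq_or_ne n 0 with rfl | hn
    · simp [hg]
    have hnpos : (0 : ℝ) < n := by exact_mod_cast Nat.pos_of_ne_zero hn
    have e : ∀ t, g n t = a n * (((n / X : ℝ) : ℂ) ^ (-((σ : ℂ) + t * Complex.I)) * K t) := by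
      intro t
      have : ((n / X : ℝ) : ℂ) = ((n : ℝ) : ℂ) * ((X⁻¹ : ℝ) : ℂ) := by
        push_cast; rw [div_eq_mul_inv]
      simp only [hg, LSeries.term_of_ne_zero hn]
      rw [this, Complex.mul_cpow_ofReal_nonneg hnpos.le (by positivity), Complex.ofReal_inv,
        Complex.inv_cpow _ _ (by rw [Complex.arg_ofReal_of_nonneg hX.le]; exact Real.pi_pos.ne),
        Complex.cpow_neg, Complex.cpow_neg, inv_inv, Complex.ofReal_natCast]
      ring
    simp only [e]
    rw [MeasureTheory.integral_const_mul, hK, integral_cpow_mul_rieszKernel hσ (by positivity)]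
    split_ifs with h
    · have : (n : ℝ) ≤ X := (Nat.le_floor_iff hX.le).1 (mem_Ioc.1 h).2
      rw [max_eq_left (by rw [sub_nonneg, div_le_one hX]; exact this)]
      ring
    · have : X ≤ n := by
        by_contra! h'
        exact h (mem_Ioc.2 ⟨Nat.pos_of_ne_zero hn, Nat.le_floor h'.le⟩)
      rw [max_eq_right (by rw [sub_nonpos, one_le_div hX]; exact this)]
      simp
  have key := MeasureTheory.hasSum_integral_of_summable_integral_norm hgi hsum
  simp only [hval] at key
  have key2 := key.unique (hasSum_sum_of_ne_finset_zero (s := Ioc 0 ⌊X⌋₊) fun n hn => if_neg hn)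
  rw [Finset.sum_ite_mem, Finset.inter_self, ← Finset.mul_sum] at key2
  have hts : ∀ t, ∑' n, g n t
      = LSeries a (σ + t * Complex.I) * ((X : ℂ) ^ ((σ : ℂ) + t * Complex.I) * K t) := by
    intro t
    simp only [hg, tsum_mul_right]
    rfl
  have hC0 : 0 ≤ C := by simpa using (norm_nonneg _).trans (hC 0)
  have hbd : ‖∫ t, ∑' n, g n t‖ ≤ ∫ t : ℝ, C * X ^ σ * (1 + t ^ 2) ^ (-(3 / 4) : ℝ) := by
    apply MeasureTheory.norm_integral_le_of_norm_le (integrable_one_add_sq_rpow.const_mul _)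
    refine Eventually.of_forall fun t => ?_
    rw [hts, norm_mul, norm_mul, hXn]
    have h0 : 0 < 1 + t ^ 2 := by positivity
    have : (1 + t ^ 2) ^ (-(3 / 4) : ℝ) = (1 + t ^ 2) ^ (1 / 4 : ℝ) * (1 + t ^ 2)⁻¹ := by
      rw [← Real.rpow_neg_one, ← Real.rpow_add h0]
      norm_num
    rw [this]
    calc _ ≤ (C * (1 + t ^ 2) ^ (1 / 4 : ℝ)) * (X ^ σ * (1 + t ^ 2)⁻¹) := by
          gcongr
          · exact hC t
          · exact norm_rieszKernel_le hσ t
      _ = _ := by ring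
  rw [key2, MeasureTheory.integral_const_mul, norm_mul] at hbd
  have hpi : (1 : ℝ) ≤ ‖(2 * Real.pi : ℂ)‖ := by
    rw [norm_mul, Complex.norm_real, Real.norm_of_nonneg Real.pi_pos.le]
    norm_num
    linarith [Real.pi_gt_three]
  exact (le_mul_of_one_le_left (norm_nonneg _) hpi).trans hbd

/-- The difference between `n ^ (-s)` and the integral of `u ^ (-s)` over `[n, n + 1]`. -/
noncomputable def zetaTerm (n : ℕ) (s : ℂ) : ℂ :=
  (n : ℂ) ^ (-s) - (((n + 1 : ℕ) : ℂ) ^ (1 - s) - (n : ℂ) ^ (1 - s)) / (1 - s)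

lemma norm_cpow_neg_sub_le {n : ℕ} (hn : 1 ≤ n) {s : ℂ} (hs : 0 < s.re) {u : ℝ}
    (hu : u ∈ Set.Icc (n : ℝ) (n + 1)) :
    ‖(n : ℂ) ^ (-s) - (u : ℂ) ^ (-s)‖ ≤ ‖s‖ * (n : ℝ) ^ (-s.re - 1) := by
  have hn0 : (0 : ℝ) < n := by exact_mod_cast hn
  have hs0 : s ≠ 0 := by rintro rfl; simp at hs
  have h := Convex.norm_image_sub_le_of_norm_hasDerivWithin_le (𝕜 := ℝ)
    (f := fun v : ℝ => (v : ℂ) ^ (-s)) (f' := fun v : ℝ => -s * (v : ℂ) ^ (-s - 1))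
    (s := Set.Icc (n : ℝ) (n + 1)) (x := u) (y := n) (C := ‖s‖ * (n : ℝ) ^ (-s.re - 1))
    (fun v hv => (hasDerivAt_ofReal_cpow_const (hn0.trans_le hv.1).ne'
      (neg_ne_zero.2 hs0)).hasDerivWithinAt)
    (fun v hv => by
      rw [norm_mul, norm_neg, Complex.norm_cpow_eq_rpow_re_of_pos (hn0.trans_le hv.1)]
      gcongr ?_ * ?_
      simp only [Complex.sub_re, Complex.neg_re, Complex.one_re]
      exact Real.rpow_le_rpow_of_nonpos hn0 hv.1 (by linarith))
    (convex_Icc _ _) hu (by simp)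
  refine (by simpa using h : _ ≤ ‖s‖ * (n : ℝ) ^ (-s.re - 1) * |(n : ℝ) - u|).trans ?_
  apply mul_le_of_le_one_right (by positivity)
  rw [abs_le]
  constructor <;> linarith [hu.1, hu.2]

lemma norm_zetaTerm_le {n : ℕ} (hn : 1 ≤ n) {s : ℂ} (hs : 0 < s.re) (hs1 : s ≠ 1) :
    ‖zetaTerm n s‖ ≤ ‖s‖ * (n : ℝ) ^ (-s.re - 1) := by
  have hn0 : (0 : ℝ) < n := by exact_mod_cast hn
  have hs' : 1 - s ≠ 0 := sub_ne_zero.2 hs1.symm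
  have h := Convex.norm_image_sub_le_of_norm_hasDerivWithin_le (𝕜 := ℝ)
    (f := fun v : ℝ => (n : ℂ) ^ (-s) * v - (v : ℂ) ^ (1 - s) / (1 - s))
    (f' := fun v : ℝ => (n : ℂ) ^ (-s) - (v : ℂ) ^ (-s))
    (s := Set.Icc (n : ℝ) (n + 1)) (x := n) (y := n + 1) (C := ‖s‖ * (n : ℝ) ^ (-s.re - 1))
    (fun v hv => by
      have h1 := (hasDerivAt_ofReal_cpow_const (hn0.trans_le hv.1).ne' hs').div_const (1 - s)
      have h2 := (Complex.ofRealCLM.hasDerivAt (x := v)).const_mul ((n : ℂ) ^ (-s))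
      have : (1 - s) - 1 = -s := by ring
      rw [this, mul_div_cancel_left₀ _ hs'] at h1
      simpa using! (h2.sub h1).hasDerivWithinAt)
    (fun v hv => norm_cpow_neg_sub_le hn hs hv)
    (convex_Icc _ _) (by simp) (by simp)
  have e : zetaTerm n s = ((n : ℂ) ^ (-s) * ((n + 1 : ℝ) : ℂ)
      - ((n + 1 : ℝ) : ℂ) ^ (1 - s) / (1 - s))
      - ((n : ℂ) ^ (-s) * ((n : ℝ) : ℂ) - ((n : ℝ) : ℂ) ^ (1 - s) / (1 - s)) := by
    unfold zetaTerm
    push_cast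
    ring
  rw [e]
  simpa using h

lemma norm_zetaTerm_le_rpow {n : ℕ} (hn : 1 ≤ n) {s : ℂ} {a : ℝ} (ha : 0 < a) (hs : a ≤ s.re)
    (hs1 : s ≠ 1) : ‖zetaTerm n s‖ ≤ ‖s‖ * (n : ℝ) ^ (-a - 1) := by
  refine (norm_zetaTerm_le hn (ha.trans_le hs) hs1).trans ?_
  gcongr
  exact_mod_cast hn

lemma summable_nat_add_rpow (N : ℕ) {a : ℝ} (ha : 0 < a) :
    Summable fun n : ℕ => ((n + N : ℕ) : ℝ) ^ (-a - 1) :=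
  (summable_nat_add_iff N).2 (Real.summable_nat_rpow.2 (by linarith))

lemma summable_zetaTerm {N : ℕ} (hN : 1 ≤ N) {s : ℂ} (hs : 0 < s.re) (hs1 : s ≠ 1) :
    Summable fun n : ℕ => zetaTerm (n + N) s :=
  ((summable_nat_add_rpow N hs).mul_left ‖s‖).of_norm_bounded
    fun n => norm_zetaTerm_le (by lia) hs hs1

/-- The approximation of `ζ` by its `N`-th partial sum, with the exact remainder. -/
noncomputable def zetaApprox (N : ℕ) (s : ℂ) : ℂ :=
  ∑ n ∈ range N, 1 / (n : ℂ) ^ s + (N : ℂ) ^ (1 - s) / (s - 1) + ∑' n : ℕ, zetaTerm (n + N) s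

lemma zeta_eq_zetaApprox {N : ℕ} (hN : 1 ≤ N) {s : ℂ} (hs : 1 < s.re) :
    riemannZeta s = zetaApprox N s := by
  have hs1 : s ≠ 1 := by rintro rfl; simp at hs
  have hs' : 1 - s ≠ 0 := sub_ne_zero.2 hs1.symm
  have hsum : Summable fun n : ℕ => 1 / (n : ℂ) ^ s := Complex.summable_one_div_nat_cpow.2 hs
  rw [zeta_eq_tsum_one_div_nat_cpow hs, ← hsum.sum_add_tsum_nat_add N, zetaApprox, add_assoc]
  congr 1
  set b : ℕ → ℂ := fun n => ((n + N : ℕ) : ℂ) ^ (1 - s) / (1 - s) with hb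
  have hsplit : ∀ n : ℕ, 1 / ((n + N : ℕ) : ℂ) ^ s - zetaTerm (n + N) s = b (n + 1) - b n := by
    intro n
    simp only [zetaTerm, hb, Complex.cpow_neg]
    rw [show n + 1 + N = n + N + 1 by ring]
    ring
  have hs1' := (summable_nat_add_iff N).2 hsum
  have hs2 := summable_zetaTerm hN (by linarith) hs1
  have hts := (hs1'.sub hs2).hasSum
  rw [hs1'.tsum_sub hs2] at hts
  have hlim := hts.tendsto_sum_nat
  simp only [hsplit, Finset.sum_range_sub] at hlim
  have hb0 : Tendsto b atTop (nhds 0) := by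
    rw [tendsto_zero_iff_norm_tendsto_zero]
    have h1 : Tendsto (fun n : ℕ => ((n + N : ℕ) : ℝ) ^ (-(s.re - 1)) / ‖1 - s‖) atTop
        (nhds (0 / ‖1 - s‖)) := by
      refine Tendsto.div_const ?_ _
      exact (tendsto_rpow_neg_atTop (by linarith)).comp
        (tendsto_natCast_atTop_atTop.comp (tendsto_add_atTop_nat N))
    rw [zero_div] at h1
    refine h1.congr fun n => ?_
    rw [hb]
    simp only [norm_div]
    rw [Complex.norm_natCast_cpow_of_pos (by lia)]
    simp
  have := tendsto_nhds_unique hlim (hb0.sub_const (b 0))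
  rw [sub_eq_iff_eq_add] at this
  rw [this]
  simp only [hb, Nat.zero_add]
  have : s - 1 ≠ 0 := sub_ne_zero.2 hs1
  field_simp
  ring

lemma differentiableOn_zetaTerm {n : ℕ} (hn : 1 ≤ n) {U : Set ℂ} (hU : ∀ s ∈ U, s ≠ 1) :
    DifferentiableOn ℂ (zetaTerm n) U := by
  intro s hs
  have h1 : (n : ℂ) ≠ 0 := by exact_mod_cast (by lia : n ≠ 0)
  have h2 : ((n + 1 : ℕ) : ℂ) ≠ 0 := by exact_mod_cast (by lia : n + 1 ≠ 0)
  have h3 : 1 - s ≠ 0 := sub_ne_zero.2 (hU s hs).symm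
  unfold zetaTerm
  refine DifferentiableAt.differentiableWithinAt ?_
  have h4 : DifferentiableAt ℂ (fun s : ℂ => 1 - s) s := by fun_prop
  exact (differentiableAt_id.neg.const_cpow (Or.inl h1)).sub
    (((h4.const_cpow (Or.inl h2)).sub (h4.const_cpow (Or.inl h1))).div h4 h3)

lemma differentiableOn_zetaApprox {N : ℕ} (hN : 1 ≤ N) {a R : ℝ} (ha : 0 < a) {U : Set ℂ}
    (hUo : IsOpen U) (hUre : ∀ s ∈ U, a ≤ s.re) (hUn : ∀ s ∈ U, ‖s‖ ≤ R) (hU : ∀ s ∈ U, s ≠ 1) :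
    DifferentiableOn ℂ (zetaApprox N) U := by
  unfold zetaApprox
  refine DifferentiableOn.add (DifferentiableOn.add ?_ ?_) ?_
  · refine DifferentiableOn.fun_sum fun n _ s hs => DifferentiableAt.differentiableWithinAt ?_
    have hs0 : s ≠ 0 := by
      rintro rfl
      have := hUre _ hs
      simp at this
      linarith
    rcases eq_or_ne n 0 with rfl | hn
    · have : (fun s : ℂ => 1 / ((0 : ℕ) : ℂ) ^ s) =ᶠ[nhds s] fun _ => 0 := by
        filter_upwards [isOpen_ne.mem_nhds hs0] with z hz
        simp [Complex.zero_cpow hz]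
      exact this.symm.differentiableAt_iff.1 (differentiableAt_const _)
    · have h1 : (n : ℂ) ≠ 0 := by exact_mod_cast hn
      exact (differentiableAt_const _).div (differentiableAt_id.const_cpow (Or.inl h1))
        (by simp [Complex.cpow_eq_zero_iff, h1])
  · intro s hs
    have h1 : (N : ℂ) ≠ 0 := by exact_mod_cast (by lia : N ≠ 0)
    have h4 : DifferentiableAt ℂ (fun s : ℂ => 1 - s) s := by fun_prop
    have h5 : DifferentiableAt ℂ (fun s : ℂ => s - 1) s := by fun_prop
    exact ((h4.const_cpow (Or.inl h1)).div h5
      (sub_ne_zero.2 (hU s hs))).differentiableWithinAt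
  · refine Complex.differentiableOn_tsum_of_summable_norm
      ((summable_nat_add_rpow N ha).mul_left R)
      (fun n => differentiableOn_zetaTerm (by lia) hU) hUo fun n s hs => ?_
    refine (norm_zetaTerm_le_rpow (by lia) ha (hUre s hs) (hU s hs)).trans ?_
    gcongr
    exact hUn s hs

lemma norm_zetaApprox_le {N : ℕ} (hN : 1 ≤ N) {η : ℝ} (hη : 0 < η) (hη2 : η ≤ 1 / 2) {s : ℂ}
    (hs : 1 - η ≤ s.re) (hs1 : 1 / 2 ≤ ‖s - 1‖) (hsN : ‖s‖ ≤ 4 * N) :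
    ‖zetaApprox N s‖ ≤ (N : ℝ) ^ (2 * η) * (5 * ∑' n : ℕ, (n : ℝ) ^ (-η - 1) + 2) := by
  have hN1 : (1 : ℝ) ≤ N := by exact_mod_cast hN
  have hN0 : (0 : ℝ) < N := by linarith
  have hne : s ≠ 1 := by rintro rfl; norm_num at hs1
  have hre : 0 < s.re := by linarith
  have hs0 : s ≠ 0 := by rintro rfl; simp at hre
  set S := ∑' n : ℕ, (n : ℝ) ^ (-η - 1) with hS
  have hsumm : Summable fun n : ℕ => (n : ℝ) ^ (-η - 1) := Real.summable_nat_rpow.2 (by linarith)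
  have h1 : ‖∑ n ∈ range N, 1 / (n : ℂ) ^ s‖ ≤ (N : ℝ) ^ (2 * η) * S := by
    calc _ ≤ ∑ n ∈ range N, (N : ℝ) ^ (2 * η) * (n : ℝ) ^ (-η - 1) := by
          refine norm_sum_le_of_le _ fun n hn => ?_
          rcases eq_or_ne n 0 with rfl | hn0
          · simp only [Nat.cast_zero, Complex.zero_cpow hs0]
            simp only [div_zero, norm_zero]
            positivity
          have hn1 : (1 : ℝ) ≤ n := by exact_mod_cast Nat.pos_of_ne_zero hn0
          have hnN : (n : ℝ) ≤ N := by exact_mod_cast (mem_range.1 hn).le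
          rw [norm_div, norm_one, Complex.norm_natCast_cpow_of_pos (Nat.pos_of_ne_zero hn0),
            one_div, ← Real.rpow_neg (by positivity)]
          calc (n : ℝ) ^ (-s.re) ≤ (n : ℝ) ^ (2 * η + (-η - 1)) := by
                gcongr
                linarith
            _ = (n : ℝ) ^ (2 * η) * (n : ℝ) ^ (-η - 1) := Real.rpow_add (by linarith) _ _
            _ ≤ _ := by gcongr
      _ = (N : ℝ) ^ (2 * η) * ∑ n ∈ range N, (n : ℝ) ^ (-η - 1) := by rw [mul_sum]
      _ ≤ _ := by
          gcongr
          exact hsumm.sum_le_tsum _ fun n _ => by positivity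
  have h2 : ‖(N : ℂ) ^ (1 - s) / (s - 1)‖ ≤ (N : ℝ) ^ (2 * η) * 2 := by
    rw [norm_div, Complex.norm_natCast_cpow_of_pos (by lia), div_eq_mul_inv]
    gcongr
    · simp only [Complex.sub_re, Complex.one_re]; linarith
    · rw [show (2 : ℝ) = (1 / 2)⁻¹ by norm_num]
      exact inv_anti₀ (by norm_num) hs1
  have h3 : ‖∑' n : ℕ, zetaTerm (n + N) s‖ ≤ (N : ℝ) ^ (2 * η) * (4 * S) := by
    have hsum' := (summable_nat_add_iff N).2 hsumm
    have hterm : ∀ n : ℕ, ‖zetaTerm (n + N) s‖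
        ≤ (N : ℝ) ^ (2 * η) * 4 * ((n + N : ℕ) : ℝ) ^ (-η - 1) := by
      intro n
      have hnN : (N : ℝ) ≤ ((n + N : ℕ) : ℝ) := by exact_mod_cast (by lia : N ≤ n + N)
      have hpos : (0 : ℝ) < ((n + N : ℕ) : ℝ) := by linarith
      refine (norm_zetaTerm_le_rpow (by lia) (by linarith) hs hne).trans ?_
      calc ‖s‖ * ((n + N : ℕ) : ℝ) ^ (-(1 - η) - 1)
          = ‖s‖ * (((n + N : ℕ) : ℝ) ^ (2 * η - 1) * ((n + N : ℕ) : ℝ) ^ (-η - 1)) := by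
            rw [← Real.rpow_add hpos]; ring_nf
        _ ≤ (4 * N) * ((N : ℝ) ^ (2 * η - 1) * ((n + N : ℕ) : ℝ) ^ (-η - 1)) := by
            gcongr ?_ * (?_ * _)
            exact Real.rpow_le_rpow_of_nonpos hN0 hnN (by linarith)
        _ = _ := by
            rw [Real.rpow_sub_one hN0.ne']
            field_simp
    refine (tsum_of_norm_bounded (hsum'.mul_left _).hasSum hterm).trans ?_
    rw [tsum_mul_left, mul_assoc]
    gcongr
    rw [hS, ← hsumm.sum_add_tsum_nat_add N]
    exact le_add_of_nonneg_left (sum_nonneg fun n _ => by positivity)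
  calc ‖zetaApprox N s‖ ≤ (N : ℝ) ^ (2 * η) * S + (N : ℝ) ^ (2 * η) * 2
        + (N : ℝ) ^ (2 * η) * (4 * S) := by
        unfold zetaApprox
        exact (norm_add_le _ _).trans (add_le_add ((norm_add_le _ _).trans (add_le_add h1 h2)) h3)
    _ = _ := by ring

/-- A function is of subpolynomial growth on vertical lines, uniformly to the right of
`Re s = 1`. -/
def SubpolyBound (f : ℂ → ℂ) : Prop :=
  ∀ ε : ℝ, 0 < ε → ∃ C : ℝ, ∀ s : ℂ, 1 < s.re → s.re ≤ 2 → 1 ≤ |s.im| → ‖f s‖ ≤ C * |s.im| ^ ε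

lemma subpolyBound_iteratedDeriv_riemannZeta (k : ℕ) :
    SubpolyBound (iteratedDeriv k riemannZeta) := by
  suffices H : ∀ η : ℝ, 0 < η → η ≤ 1 / 2 → ∃ C : ℝ, ∀ s : ℂ, 1 < s.re → s.re ≤ 2 →
      1 ≤ |s.im| → ‖iteratedDeriv k riemannZeta s‖ ≤ C * |s.im| ^ (2 * η) by
    intro ε hε
    obtain ⟨C, hC⟩ := H (min (ε / 2) (1 / 2)) (by positivity) (min_le_right _ _)
    refine ⟨|C|, fun s h1 h2 h3 => (hC s h1 h2 h3).trans ?_⟩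
    gcongr
    · exact le_abs_self C
    · linarith [min_le_left (ε / 2) (1 / 2)]
  intro η hη hη2
  set S := ∑' n : ℕ, (n : ℝ) ^ (-η - 1) with hS
  have hS0 : 0 ≤ S := tsum_nonneg fun n => by positivity
  refine ⟨k.factorial * (2 ^ (2 * η) * (5 * S + 2)) / η ^ k, fun s hs1 hs2 him => ?_⟩
  set N := ⌈|s.im|⌉₊ with hN
  have hN1 : 1 ≤ N := Nat.one_le_ceil_iff.2 (by linarith)
  have hNle : |s.im| ≤ N := Nat.le_ceil _
  have hNlt : (N : ℝ) ≤ 2 * |s.im| := by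
    have := Nat.ceil_lt_add_one (abs_nonneg s.im)
    linarith
  have hloc : riemannZeta =ᶠ[nhds s] zetaApprox N := by
    filter_upwards [(isOpen_lt continuous_const Complex.continuous_re).mem_nhds hs1] with z hz
    exact zeta_eq_zetaApprox hN1 hz
  rw [hloc.iteratedDeriv_eq]
  have hdist : ∀ z r, ‖z - s‖ ≤ r → s.re - r ≤ z.re ∧ |s.im| - r ≤ |z.im| ∧ ‖z‖ ≤ ‖s‖ + r := by
    intro z r hz
    have h1 := (abs_le.1 ((Complex.abs_re_le_norm (z - s)).trans hz)).1
    have h2 := (Complex.abs_im_le_norm (z - s)).trans hz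
    have h3 := norm_sub_norm_le z s
    have h4 := abs_sub_abs_le_abs_sub s.im z.im
    rw [abs_sub_comm] at h4
    simp only [Complex.sub_re, Complex.sub_im] at h1 h2
    exact ⟨by linarith, by linarith, by linarith⟩
  have hns : ‖s‖ ≤ 2 + |s.im| := by
    have := Complex.norm_le_abs_re_add_abs_im s
    rw [abs_of_pos (by linarith : 0 < s.re)] at this
    linarith
  have him1 : ∀ z : ℂ, |z.im| ≤ ‖z - 1‖ := fun z => by
    simpa using Complex.abs_im_le_norm (z - 1)
  have hU : ∀ z ∈ Metric.ball s (3 / 4), ‖z - s‖ ≤ 3 / 4 := fun z hz => by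
    rw [Metric.mem_ball, dist_eq_norm] at hz; exact hz.le
  have hd : DifferentiableOn ℂ (zetaApprox N) (Metric.ball s (3 / 4)) := by
    refine differentiableOn_zetaApprox hN1 (a := 1 / 4) (R := ‖s‖ + 3 / 4) (by norm_num)
      Metric.isOpen_ball (fun z hz => ?_) (fun z hz => (hdist z _ (hU z hz)).2.2)
      fun z hz => ?_
    · linarith [(hdist z _ (hU z hz)).1]
    · rintro rfl
      have := (hdist _ _ (hU _ hz)).2.1
      simp at this
      linarith
  have hcauchy := Complex.norm_iteratedDeriv_le_of_forall_mem_sphere_norm_le k hη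
    (hd.diffContOnCl_ball (Metric.closedBall_subset_ball (by linarith)))
    (C := (N : ℝ) ^ (2 * η) * (5 * S + 2)) (fun z hz => by
      have hz' : ‖z - s‖ ≤ η := by
        rw [mem_sphere_iff_norm] at hz; exact hz.le
      obtain ⟨h1, h2, h3⟩ := hdist z η hz'
      exact norm_zetaApprox_le hN1 hη hη2 (by linarith) ((by linarith : _ ≤ |z.im|).trans (him1 z))
        (by linarith))
  refine hcauchy.trans ?_
  calc (k.factorial : ℝ) * ((N : ℝ) ^ (2 * η) * (5 * S + 2)) / η ^ k
      ≤ k.factorial * ((2 * |s.im|) ^ (2 * η) * (5 * S + 2)) / η ^ k := by gcongr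
    _ = _ := by
      rw [Real.mul_rpow (by norm_num) (abs_nonneg _)]
      ring

lemma SubpolyBound.congr {f g : ℂ → ℂ} (hf : SubpolyBound f)
    (h : Set.EqOn f g {s | 1 < s.re}) : SubpolyBound g := by
  intro ε hε
  obtain ⟨C, hC⟩ := hf ε hε
  exact ⟨C, fun s h1 h2 h3 => by rw [← h h1]; exact hC s h1 h2 h3⟩

lemma SubpolyBound.neg {f : ℂ → ℂ} (hf : SubpolyBound f) : SubpolyBound fun s => -f s := by
  intro ε hε
  obtain ⟨C, hC⟩ := hf ε hε
  exact ⟨C, fun s h1 h2 h3 => by rw [norm_neg]; exact hC s h1 h2 h3⟩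

lemma SubpolyBound.add {f g : ℂ → ℂ} (hf : SubpolyBound f) (hg : SubpolyBound g) :
    SubpolyBound fun s => f s + g s := by
  intro ε hε
  obtain ⟨C, hC⟩ := hf ε hε
  obtain ⟨D, hD⟩ := hg ε hε
  refine ⟨C + D, fun s h1 h2 h3 => (norm_add_le _ _).trans ?_⟩
  rw [add_mul]
  exact add_le_add (hC s h1 h2 h3) (hD s h1 h2 h3)

lemma SubpolyBound.mul {f g : ℂ → ℂ} (hf : SubpolyBound f) (hg : SubpolyBound g) :
    SubpolyBound fun s => f s * g s := by
  intro ε hε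
  obtain ⟨C, hC⟩ := hf (ε / 2) (by positivity)
  obtain ⟨D, hD⟩ := hg (ε / 2) (by positivity)
  refine ⟨C * D, fun s h1 h2 h3 => ?_⟩
  have h0 : 0 < |s.im| := by linarith
  rw [norm_mul]
  calc ‖f s‖ * ‖g s‖ ≤ (C * |s.im| ^ (ε / 2)) * (D * |s.im| ^ (ε / 2)) := by
        gcongr
        · exact (norm_nonneg _).trans (hC s h1 h2 h3)
        · exact hC s h1 h2 h3
        · exact hD s h1 h2 h3
    _ = C * D * (|s.im| ^ (ε / 2) * |s.im| ^ (ε / 2)) := by ring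
    _ = _ := by rw [← Real.rpow_add h0, add_halves]

/-- The derivatives of `f` up to order `k` are of subpolynomial growth to the right of
`Re s = 1`. -/
def SubpolyDerivs (k : ℕ) (f : ℂ → ℂ) : Prop :=
  ∀ j ≤ k, SubpolyBound (iteratedDeriv j f)

lemma isOpen_one_lt_re : IsOpen {s : ℂ | 1 < s.re} :=
  isOpen_lt continuous_const Complex.continuous_re

lemma SubpolyDerivs.congr {k : ℕ} {f g : ℂ → ℂ} (hf : SubpolyDerivs k f)
    (h : Set.EqOn f g {s | 1 < s.re}) : SubpolyDerivs k g := by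
  intro j hj
  refine (hf j hj).congr fun s hs => Filter.EventuallyEq.iteratedDeriv_eq j ?_
  filter_upwards [isOpen_one_lt_re.mem_nhds hs] with z hz using h hz

lemma subpolyDerivs_zero_iff {f : ℂ → ℂ} : SubpolyDerivs 0 f ↔ SubpolyBound f := by
  simp [SubpolyDerivs]

lemma subpolyDerivs_succ_iff {k : ℕ} {f : ℂ → ℂ} :
    SubpolyDerivs (k + 1) f ↔ SubpolyBound f ∧ SubpolyDerivs k (deriv f) := by
  constructor
  · intro h
    refine ⟨by simpa using h 0 (by lia), fun j hj => ?_⟩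
    rw [← iteratedDeriv_succ']
    exact h (j + 1) (by lia)
  · rintro ⟨h0, h⟩ j hj
    rcases j with - | j
    · simpa using h0
    · rw [iteratedDeriv_succ']
      exact h j (by lia)

lemma SubpolyDerivs.mono {k l : ℕ} {f : ℂ → ℂ} (h : SubpolyDerivs k f) (hl : l ≤ k) :
    SubpolyDerivs l f := fun j hj => h j (hj.trans hl)

lemma SubpolyDerivs.subpolyBound {k : ℕ} {f : ℂ → ℂ} (h : SubpolyDerivs k f) :
    SubpolyBound f := by simpa using h 0 (by lia)

lemma SubpolyDerivs.neg {k : ℕ} {f : ℂ → ℂ} (hf : SubpolyDerivs k f) :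
    SubpolyDerivs k fun s => -f s := by
  intro j hj
  have : iteratedDeriv j (fun s => -f s) = fun s => -iteratedDeriv j f s := by
    ext s
    exact iteratedDeriv_fun_neg j f s
  rw [this]
  exact (hf j hj).neg

lemma SubpolyDerivs.add {k : ℕ} : ∀ {f g : ℂ → ℂ}, DifferentiableOn ℂ f {s | 1 < s.re} →
    DifferentiableOn ℂ g {s | 1 < s.re} → SubpolyDerivs k f → SubpolyDerivs k g →
    SubpolyDerivs k fun s => f s + g s := by
  induction k with
  | zero =>
    intro f g _ _ hf hg
    exact subpolyDerivs_zero_iff.2 (hf.subpolyBound.add hg.subpolyBound)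
  | succ k ih =>
    intro f g df dg hf hg
    refine subpolyDerivs_succ_iff.2 ⟨hf.subpolyBound.add hg.subpolyBound, ?_⟩
    refine (ih (df.deriv isOpen_one_lt_re) (dg.deriv isOpen_one_lt_re)
      (subpolyDerivs_succ_iff.1 hf).2 (subpolyDerivs_succ_iff.1 hg).2).congr fun s hs => ?_
    exact (deriv_fun_add (df.differentiableAt (isOpen_one_lt_re.mem_nhds hs))
      (dg.differentiableAt (isOpen_one_lt_re.mem_nhds hs))).symm

lemma SubpolyDerivs.mul {k : ℕ} : ∀ {f g : ℂ → ℂ}, DifferentiableOn ℂ f {s | 1 < s.re} →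
    DifferentiableOn ℂ g {s | 1 < s.re} → SubpolyDerivs k f → SubpolyDerivs k g →
    SubpolyDerivs k fun s => f s * g s := by
  induction k with
  | zero =>
    intro f g _ _ hf hg
    exact subpolyDerivs_zero_iff.2 (hf.subpolyBound.mul hg.subpolyBound)
  | succ k ih =>
    intro f g df dg hf hg
    refine subpolyDerivs_succ_iff.2 ⟨hf.subpolyBound.mul hg.subpolyBound, ?_⟩
    have df' := df.deriv isOpen_one_lt_re
    have dg' := dg.deriv isOpen_one_lt_re
    refine (SubpolyDerivs.add (df'.mul dg) (df.mul dg')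
      (ih df' dg (subpolyDerivs_succ_iff.1 hf).2 (hg.mono (by lia)))
      (ih df dg' (hf.mono (by lia)) (subpolyDerivs_succ_iff.1 hg).2)).congr fun s hs => ?_
    exact (deriv_fun_mul (df.differentiableAt (isOpen_one_lt_re.mem_nhds hs))
      (dg.differentiableAt (isOpen_one_lt_re.mem_nhds hs))).symm

lemma SubpolyDerivs.inv {k : ℕ} {f : ℂ → ℂ} (df : DifferentiableOn ℂ f {s | 1 < s.re})
    (h0 : ∀ s : ℂ, 1 < s.re → f s ≠ 0) (hf : SubpolyDerivs k f)
    (hinv : SubpolyBound fun s => (f s)⁻¹) : SubpolyDerivs k fun s => (f s)⁻¹ := by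
  have di : DifferentiableOn ℂ (fun s => (f s)⁻¹) {s | 1 < s.re} := df.inv h0
  induction k with
  | zero => exact subpolyDerivs_zero_iff.2 hinv
  | succ k ih =>
    refine subpolyDerivs_succ_iff.2 ⟨hinv, ?_⟩
    have hi := ih (hf.mono (by lia))
    have df' := df.deriv isOpen_one_lt_re
    refine (SubpolyDerivs.mul (df'.mul di) di
      (SubpolyDerivs.mul df' di (subpolyDerivs_succ_iff.1 hf).2 hi) hi).neg.congr fun s hs => ?_
    rw [deriv_fun_inv'' (df.differentiableAt (isOpen_one_lt_re.mem_nhds hs)) (h0 s hs)]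
    have := h0 s hs
    change -(deriv f s * (f s)⁻¹ * (f s)⁻¹) = _
    field_simp

lemma differentiableOn_riemannZeta_one_lt_re :
    DifferentiableOn ℂ riemannZeta {s | 1 < s.re} := fun s hs =>
  (differentiableAt_riemannZeta (by rintro rfl; simp at hs)).differentiableWithinAt

lemma subpolyDerivs_riemannZeta (k : ℕ) : SubpolyDerivs k riemannZeta :=
  fun j _ => subpolyBound_iteratedDeriv_riemannZeta j

lemma exists_norm_riemannZeta_le : ∃ B : ℝ, ∀ x : ℝ, 0 < x → x ≤ 1 →
    ‖riemannZeta (1 + x)‖ ≤ B / x := by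
  have hc : Continuous fun x : ℝ => riemannZeta₀ (1 + x) :=
    differentiable_riemannZeta₀.continuous.comp (by fun_prop)
  obtain ⟨B, hB⟩ := (isCompact_Icc (a := (0 : ℝ)) (b := 1)).exists_bound_of_continuousOn
    hc.continuousOn
  refine ⟨1 + B, fun x hx hx1 => ?_⟩
  have hxC : (x : ℂ) ≠ 0 := by exact_mod_cast hx.ne'
  rw [riemannZeta_eq_inv_sub_add (by simpa using hxC)]
  have hB' := hB x ⟨hx.le, hx1⟩
  have hB0 := (norm_nonneg _).trans hB'
  calc _ ≤ x⁻¹ + B := by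
        refine (norm_add_le _ _).trans (add_le_add ?_ hB')
        simp [abs_of_pos hx]
    _ ≤ _ := by
        rw [le_div_iff₀ hx, add_mul, inv_mul_cancel₀ hx.ne']
        nlinarith

lemma one_le_riemannZeta_product {x : ℝ} (hx : 0 < x) (t : ℝ) :
    1 ≤ ‖riemannZeta (1 + x)‖ ^ 3 * ‖riemannZeta (1 + x + Complex.I * t)‖ ^ 4
      * ‖riemannZeta (1 + x + 2 * Complex.I * t)‖ := by
  have h := DirichletCharacter.norm_LFunction_product_ge_one (1 : DirichletCharacter ℂ 1) hx t
  simpa [DirichletCharacter.LFunctionTrivChar, DirichletCharacter.LFunction_modOne_eq] using h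

lemma norm_riemannZeta_sub_le {t M : ℝ} (ht : t ≠ 0)
    (hM : ∀ s : ℂ, 1 < s.re → s.re ≤ 2 → s.im = t → ‖deriv riemannZeta s‖ ≤ M) {x y : ℝ}
    (hx : 0 < x) (hx1 : x ≤ 1) (hy : 0 < y) (hy1 : y ≤ 1) :
    ‖riemannZeta (1 + y + Complex.I * t) - riemannZeta (1 + x + Complex.I * t)‖
      ≤ M * |y - x| := by
  have hd : ∀ v ∈ Set.Ioc (0 : ℝ) 1, HasDerivAt
      (fun v : ℝ => riemannZeta (1 + v + Complex.I * t))
      (deriv riemannZeta (1 + v + Complex.I * t)) v := by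
    intro v hv
    have h1 : HasDerivAt (fun v : ℝ => (1 + v + Complex.I * t : ℂ)) 1 v := by
      simpa using! ((Complex.ofRealCLM.hasDerivAt (x := v)).const_add 1).add_const (Complex.I * t)
    have h2 : (1 + v + Complex.I * t : ℂ) ≠ 1 := by
      intro h
      have := congrArg Complex.im h
      simp at this
      exact ht this
    simpa using! (differentiableAt_riemannZeta h2).hasDerivAt.comp v h1
  have h := Convex.norm_image_sub_le_of_norm_hasDerivWithin_le (𝕜 := ℝ)
    (fun v hv => (hd v hv).hasDerivWithinAt) (C := M) (fun v hv => hM _ (by simpa using hv.1)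
      (by have := hv.2; simp; linarith) (by simp)) (convex_Ioc (0 : ℝ) 1) ⟨hx, hx1⟩ ⟨hy, hy1⟩
  simpa using h

lemma subpolyBound_inv_riemannZeta : SubpolyBound fun s => (riemannZeta s)⁻¹ := by
  intro ε hε
  obtain ⟨B₁, hB₁⟩ := exists_norm_riemannZeta_le
  obtain ⟨B₂, hB₂⟩ := subpolyBound_iteratedDeriv_riemannZeta 0 (ε / 4) (by positivity)
  obtain ⟨B₃, hB₃⟩ := subpolyBound_iteratedDeriv_riemannZeta 1 (ε / 4) (by positivity)
  simp only [iteratedDeriv_zero, iteratedDeriv_one] at hB₂ hB₃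
  set D : ℝ := max 1 (max B₁ (max (|B₂| * 2 ^ (ε / 4)) B₃)) with hD
  have hD1 : 1 ≤ D := le_max_left _ _
  have hDB₁ : B₁ ≤ D := (le_max_left _ _).trans (le_max_right _ _)
  have hDB₂ : |B₂| * 2 ^ (ε / 4) ≤ D :=
    (le_max_left _ _).trans ((le_max_right _ _).trans (le_max_right _ _))
  have hDB₃ : B₃ ≤ D := (le_max_right _ _).trans ((le_max_right _ _).trans (le_max_right _ _))
  have hD0 : 0 < D := by linarith
  set κ : ℝ := 1 / (2 * D ^ 2) with hκ
  have hκ0 : 0 < κ := by positivity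
  have hκ1 : κ ≤ 1 := by
    rw [hκ, div_le_one (by positivity)]
    nlinarith
  refine ⟨2 * D / κ ^ 3, fun s hs1 hs2 him => ?_⟩
  obtain ⟨x, hx⟩ : ∃ x, x = s.re - 1 := ⟨_, rfl⟩
  set t := s.im with ht
  have hx0 : 0 < x := by linarith
  have hx1 : x ≤ 1 := by linarith
  have hst : s = 1 + x + Complex.I * t := by
    apply Complex.ext
    · simp [hx]
    · simp [ht]
  have ht0 : 0 < |t| := by linarith
  set T : ℝ := |t| ^ (ε / 16) with hT
  have hT1 : 1 ≤ T := Real.one_le_rpow him (by positivity)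
  have hT0 : 0 < T := by linarith
  have hT4 : |t| ^ (ε / 4) = T ^ 4 := by
    rw [hT, ← Real.rpow_natCast, ← Real.rpow_mul ht0.le]
    congr 1
    push_cast
    ring
  have hT16 : |t| ^ ε = T ^ 16 := by
    rw [hT, ← Real.rpow_natCast, ← Real.rpow_mul ht0.le]
    congr 1
    push_cast
    ring
  have low : ∀ q : ℝ, 0 < q → q ≤ 1 →
      q ^ 3 / (D * T) ≤ ‖riemannZeta (1 + (q ^ 4 : ℝ) + Complex.I * t)‖ := by
    intro q hq hq1
    have hq4 : 0 < q ^ 4 := by positivity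
    have hq41 : q ^ 4 ≤ 1 := pow_le_one₀ hq.le hq1
    have h1 := one_le_riemannZeta_product hq4 t
    have h2 : ‖riemannZeta (1 + (q ^ 4 : ℝ))‖ ≤ D / q ^ 4 :=
      (hB₁ _ hq4 hq41).trans (by gcongr)
    have h3 : ‖riemannZeta (1 + (q ^ 4 : ℝ) + 2 * Complex.I * t)‖ ≤ D * T ^ 4 := by
      have him2 : (1 + ((q ^ 4 : ℝ) : ℂ) + 2 * Complex.I * t).im = 2 * t := by
        rw [Complex.add_im, Complex.add_im, Complex.ofReal_im]; simp
      have hre2 : (1 + ((q ^ 4 : ℝ) : ℂ) + 2 * Complex.I * t).re = 1 + q ^ 4 := by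
        rw [Complex.add_re, Complex.add_re, Complex.ofReal_re]; simp
      have habs : |2 * t| = 2 * |t| := by rw [abs_mul, abs_two]
      have := hB₂ (1 + ((q ^ 4 : ℝ) : ℂ) + 2 * Complex.I * t) (by rw [hre2]; linarith)
        (by rw [hre2]; linarith) (by rw [him2, habs]; linarith)
      rw [him2, habs, Real.mul_rpow (by norm_num) ht0.le, hT4] at this
      calc _ ≤ B₂ * (2 ^ (ε / 4) * T ^ 4) := this
        _ ≤ |B₂| * (2 ^ (ε / 4) * T ^ 4) := by gcongr; exact le_abs_self _
        _ = (|B₂| * 2 ^ (ε / 4)) * T ^ 4 := by ring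
        _ ≤ _ := by gcongr
    set Z := ‖riemannZeta (1 + (q ^ 4 : ℝ) + Complex.I * t)‖ with hZ
    have h4 : 1 ≤ (D / q ^ 4) ^ 3 * Z ^ 4 * (D * T ^ 4) := h1.trans (by gcongr)
    have h5 : (q ^ 3 / (D * T)) ^ 4 ≤ Z ^ 4 := by
      rw [div_pow, div_le_iff₀ (by positivity)]
      have : (D / q ^ 4) ^ 3 * Z ^ 4 * (D * T ^ 4) = Z ^ 4 * (D * T) ^ 4 / (q ^ 3) ^ 4 := by
        field_simp
      rw [this, one_le_div (by positivity)] at h4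
      exact h4
    exact le_of_pow_le_pow_left₀ (by norm_num) (norm_nonneg _) h5
  set q₀ : ℝ := κ / T ^ 5 with hq₀
  have hq₀0 : 0 < q₀ := by positivity
  have hq₀1 : q₀ ≤ 1 := by
    rw [hq₀, div_le_one (by positivity)]
    exact hκ1.trans (one_le_pow₀ hT1)
  have key : q₀ ^ 3 / (2 * (D * T)) ≤ ‖riemannZeta (1 + x + Complex.I * t)‖ := by
    rcases le_total (q₀ ^ 4) x with h | h
    · set q := x ^ (1 / 4 : ℝ) with hq
      have hq4 : q ^ 4 = x := by
        rw [hq, ← Real.rpow_natCast, ← Real.rpow_mul hx0.le]; norm_num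
      have hq0 : 0 < q := Real.rpow_pos_of_pos hx0 _
      have hqq : q₀ ≤ q := le_of_pow_le_pow_left₀ (n := 4) (by norm_num) hq0.le (by rwa [hq4])
      have := low q hq0 (Real.rpow_le_one hx0.le hx1 (by norm_num))
      rw [hq4] at this
      refine le_trans ?_ this
      have hDT : 0 < D * T := by positivity
      exact div_le_div₀ (by positivity) (by gcongr) hDT (by linarith)
    · have h1 := low q₀ hq₀0 hq₀1
      have h2 := norm_riemannZeta_sub_le (t := t) (M := D * T ^ 4) (abs_pos.1 ht0)
        (fun z hz1 hz2 hz => by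
          refine (hB₃ z hz1 hz2 (by rw [hz]; exact him)).trans ?_
          rw [hz, hT4]
          gcongr) hx0 hx1 (by positivity : 0 < q₀ ^ 4) (pow_le_one₀ hq₀0.le hq₀1)
      have h3 : |q₀ ^ 4 - x| ≤ q₀ ^ 4 := by rw [abs_of_nonneg (by linarith)]; linarith
      have h4 := norm_sub_norm_le (riemannZeta (1 + (q₀ ^ 4 : ℝ) + Complex.I * t))
        (riemannZeta (1 + x + Complex.I * t))
      have h5 : D * T ^ 4 * |q₀ ^ 4 - x| ≤ D * T ^ 4 * q₀ ^ 4 := by gcongr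
      have h6 : D * T ^ 4 * q₀ ^ 4 = q₀ ^ 3 / (2 * (D * T)) := by
        have : q₀ * (2 * D ^ 2 * T ^ 5) = 1 := by
          rw [hq₀, hκ]; field_simp
        rw [eq_div_iff (by positivity)]
        calc _ = q₀ ^ 3 * (q₀ * (2 * D ^ 2 * T ^ 5)) := by ring
          _ = _ := by rw [this, mul_one]
      have h7 : q₀ ^ 3 / (D * T) = q₀ ^ 3 / (2 * (D * T)) + q₀ ^ 3 / (2 * (D * T)) := by
        field_simp
        norm_num
      linarith
  rw [hst, norm_inv, hT16]
  refine (inv_anti₀ (by positivity) key).trans_eq ?_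
  rw [hq₀]
  field_simp

lemma riemannZeta₁_ne_zero {s : ℂ} (hs : 1 ≤ s.re) : riemannZeta₁ s ≠ 0 := by
  rcases eq_or_ne s 1 with rfl | h
  · simp
  · have := riemannZeta_ne_zero_of_one_le_re hs
    rw [riemannZeta_eq_inv_sub_mul h] at this
    exact right_ne_zero_of_mul this

/-- The Dirichlet series with coefficients `Λ(n) - 1`, as a meromorphic function. -/
noncomputable def vonMangoldtSubOneSeries (s : ℂ) : ℂ :=
  -(deriv riemannZeta s * (riemannZeta s)⁻¹) + -riemannZeta s

lemma vonMangoldtSubOneSeries_eq {s : ℂ} (hs : s ≠ 1) (h0 : riemannZeta₁ s ≠ 0) :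
    vonMangoldtSubOneSeries s = -(deriv riemannZeta₁ s / riemannZeta₁ s) - riemannZeta₀ s := by
  have h1 : s - 1 ≠ 0 := sub_ne_zero.2 hs
  have h2 := riemannZeta_eq_inv_sub_add hs
  unfold vonMangoldtSubOneSeries
  rw [deriv_riemannZeta_eq_neg_inv_sub_sq_mul_add hs, riemannZeta_eq_inv_sub_mul hs]
  rw [riemannZeta_eq_inv_sub_mul hs] at h2
  have h3 : riemannZeta₀ s = (s - 1)⁻¹ * riemannZeta₁ s - (s - 1)⁻¹ := by rw [h2]; ring
  rw [h3]
  field_simp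
  ring

lemma exists_norm_iteratedDeriv_vonMangoldtSubOneSeries_le (k : ℕ) :
    ∃ C : ℝ, ∀ s : ℂ, 1 < s.re → s.re ≤ 2 →
      ‖iteratedDeriv k vonMangoldtSubOneSeries s‖ ≤ C * (1 + s.im ^ 2) ^ (1 / 4 : ℝ) := by
  have dz := differentiableOn_riemannZeta_one_lt_re
  have dz' := dz.deriv isOpen_one_lt_re
  have di : DifferentiableOn ℂ (fun s => (riemannZeta s)⁻¹) {s | 1 < s.re} :=
    dz.inv fun s hs => riemannZeta_ne_zero_of_one_lt_re hs
  have hbig : SubpolyDerivs k vonMangoldtSubOneSeries :=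
    SubpolyDerivs.add (dz'.mul di).neg dz.neg
      (SubpolyDerivs.mul dz' di (subpolyDerivs_succ_iff.1 (subpolyDerivs_riemannZeta (k + 1))).2
        (SubpolyDerivs.inv dz (fun s hs => riemannZeta_ne_zero_of_one_lt_re hs)
          (subpolyDerivs_riemannZeta k) subpolyBound_inv_riemannZeta)).neg
      (subpolyDerivs_riemannZeta k).neg
  obtain ⟨C₁, hC₁⟩ := hbig k le_rfl (1 / 2) (by norm_num)
  set U : Set ℂ := {s | riemannZeta₁ s ≠ 0} with hU
  have hUo : IsOpen U := isOpen_ne_fun differentiable_riemannZeta₁.continuous continuous_const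
  set G : ℂ → ℂ := fun s => -(deriv riemannZeta₁ s / riemannZeta₁ s) - riemannZeta₀ s with hG
  have hGd : DifferentiableOn ℂ G U := by
    refine ((differentiable_riemannZeta₁.differentiableOn.deriv hUo).div
      differentiable_riemannZeta₁.differentiableOn fun s hs => hs).neg.sub
      differentiable_riemannZeta₀.differentiableOn
  have hGc : ContinuousOn (iteratedDeriv k G) U := by
    rw [iteratedDeriv_eq_iterate]
    exact ((hGd.analyticOnNhd hUo).iterated_deriv k).continuousOn
  obtain ⟨C₂, hC₂⟩ := ((isCompact_Icc (a := (1 : ℝ)) (b := 2)).reProdIm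
    (isCompact_Icc (a := (-1 : ℝ)) (b := 1))).exists_bound_of_continuousOn
    (hGc.mono fun s hs => riemannZeta₁_ne_zero hs.1.1)
  refine ⟨max |C₁| C₂, fun s hs1 hs2 => ?_⟩
  rcases le_total 1 |s.im| with h | h
  · refine (hC₁ s hs1 hs2 h).trans ?_
    have : |s.im| ^ (1 / 2 : ℝ) ≤ (1 + s.im ^ 2) ^ (1 / 4 : ℝ) := by
      calc |s.im| ^ (1 / 2 : ℝ) = (|s.im| ^ (2 : ℕ)) ^ (1 / 4 : ℝ) := by
            rw [← Real.rpow_natCast, ← Real.rpow_mul (abs_nonneg _)]; norm_num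
        _ ≤ _ := by
            rw [sq_abs]
            gcongr
            linarith
    calc _ ≤ |C₁| * |s.im| ^ (1 / 2 : ℝ) := by gcongr; exact le_abs_self _
      _ ≤ _ := by
        gcongr
        exact le_max_left _ _
  · have hloc : vonMangoldtSubOneSeries =ᶠ[nhds s] G := by
      filter_upwards [isOpen_one_lt_re.mem_nhds hs1] with z hz
      exact vonMangoldtSubOneSeries_eq (by rintro rfl; simp at hz)
        (riemannZeta₁_ne_zero (le_of_lt hz))
    rw [hloc.iteratedDeriv_eq]
    have h1 := hC₂ s ⟨⟨hs1.le, hs2⟩, abs_le.1 h⟩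
    refine (h1.trans (le_max_right |C₁| C₂)).trans ?_
    apply le_mul_of_one_le_right ((abs_nonneg C₁).trans (le_max_left _ _))
    exact Real.one_le_rpow (by nlinarith) (by norm_num)

/-- The coefficients `Λ(n) - 1`. -/
noncomputable def vonMangoldtSubOne (n : ℕ) : ℂ := (ArithmeticFunction.vonMangoldt n : ℂ) - 1

lemma lseriesSummable_vonMangoldtSubOne {s : ℂ} (hs : 1 < s.re) :
    LSeriesSummable vonMangoldtSubOne s :=
  (ArithmeticFunction.LSeriesSummable_vonMangoldt hs).sub (LSeriesSummable_one_iff.2 hs)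

lemma lseries_vonMangoldtSubOne {s : ℂ} (hs : 1 < s.re) :
    LSeries vonMangoldtSubOne s = vonMangoldtSubOneSeries s := by
  have h := LSeries_sub (ArithmeticFunction.LSeriesSummable_vonMangoldt hs)
    (LSeriesSummable_one_iff.2 hs)
  rw [ArithmeticFunction.LSeries_vonMangoldt_eq_deriv_riemannZeta_div hs,
    LSeries_one_eq_riemannZeta hs] at h
  refine Eq.trans h ?_
  unfold vonMangoldtSubOneSeries
  ring

lemma abscissaOfAbsConv_vonMangoldtSubOne_le :
    LSeries.abscissaOfAbsConv vonMangoldtSubOne ≤ (1 : ℝ) :=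
  LSeries.abscissaOfAbsConv_le_of_forall_lt_LSeriesSummable fun _ hy =>
    lseriesSummable_vonMangoldtSubOne (by simpa using hy)

lemma abscissaOfAbsConv_vonMangoldtSubOne_lt {s : ℂ} (hs : 1 < s.re) :
    LSeries.abscissaOfAbsConv vonMangoldtSubOne < s.re :=
  abscissaOfAbsConv_vonMangoldtSubOne_le.trans_lt (by exact_mod_cast hs)

lemma logMul_iterate_apply (f : ℕ → ℂ) (k n : ℕ) :
    LSeries.logMul^[k] f n = Complex.log n ^ k * f n := by
  induction k generalizing f with
  | zero => simp
  | succ k ih =>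
    rw [Function.iterate_succ_apply, ih, LSeries.logMul]
    ring

lemma exists_norm_lseries_logMul_le (k : ℕ) : ∃ C : ℝ, ∀ s : ℂ, 1 < s.re → s.re ≤ 2 →
    ‖LSeries (LSeries.logMul^[k] vonMangoldtSubOne) s‖ ≤ C * (1 + s.im ^ 2) ^ (1 / 4 : ℝ) := by
  obtain ⟨C, hC⟩ := exists_norm_iteratedDeriv_vonMangoldtSubOneSeries_le k
  refine ⟨C, fun s h1 h2 => ?_⟩
  refine le_trans (le_of_eq ?_) (hC s h1 h2)
  have hloc : vonMangoldtSubOneSeries =ᶠ[nhds s] LSeries vonMangoldtSubOne := by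
    filter_upwards [isOpen_one_lt_re.mem_nhds h1] with z hz
    exact (lseries_vonMangoldtSubOne hz).symm
  rw [hloc.iteratedDeriv_eq, LSeries_iteratedDeriv k (abscissaOfAbsConv_vonMangoldtSubOne_lt h1)]
  simp

/-- The summatory function of `(Λ(n) - 1) (log n) ^ k`. -/
noncomputable def psiError (k : ℕ) (x : ℝ) : ℝ :=
  ∑ n ∈ Ioc 0 ⌊x⌋₊, (ArithmeticFunction.vonMangoldt n - 1) * Real.log n ^ k

/-- The integrated summatory function of `(Λ(n) - 1) (log n) ^ k`. -/
noncomputable def psiErrorIntegral (k : ℕ) (x : ℝ) : ℝ :=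
  ∑ n ∈ Ioc 0 ⌊x⌋₊, (ArithmeticFunction.vonMangoldt n - 1) * Real.log n ^ k * (x - n)

lemma exists_abs_psiErrorIntegral_le (k : ℕ) :
    ∃ C : ℝ, 0 ≤ C ∧ ∀ x : ℝ, Real.exp 1 ≤ x → |psiErrorIntegral k x| ≤ C * x ^ 2 := by
  obtain ⟨C, hC⟩ := exists_norm_lseries_logMul_le k
  set J := ∫ t : ℝ, (1 + t ^ 2) ^ (-(3 / 4) : ℝ)
  refine ⟨|C * Real.exp 1 * J|, abs_nonneg _, fun x hx => ?_⟩
  have hx0 : 0 < x := (Real.exp_pos 1).trans_le hx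
  have hl : 1 ≤ Real.log x := by rwa [Real.le_log_iff_exp_le hx0]
  have hl0 : 0 < Real.log x := by linarith
  have hσ : 1 < 1 + 1 / Real.log x := by
    have : 0 < 1 / Real.log x := by positivity
    linarith
  have hσ2 : 1 + 1 / Real.log x ≤ 2 := by
    have : 1 / Real.log x ≤ 1 := by rwa [div_le_one hl0]
    linarith
  have hxσ : x ^ (1 + 1 / Real.log x) = x * Real.exp 1 := by
    rw [Real.rpow_add hx0, Real.rpow_one, Real.rpow_def_of_pos hx0, mul_one_div_cancel hl0.ne']
  have h := norm_rieszMean_le (a := LSeries.logMul^[k] vonMangoldtSubOne) (C := C) hσ.le hx0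
    (LSeriesSummable_of_abscissaOfAbsConv_lt_re (by
      rw [LSeries.absicssaOfAbsConv_logPowMul]
      exact abscissaOfAbsConv_vonMangoldtSubOne_lt (by rwa [Complex.ofReal_re])))
    (fun t => by
      have := hC (((1 + 1 / Real.log x : ℝ) : ℂ) + t * Complex.I)
      have hre : (((1 + 1 / Real.log x : ℝ) : ℂ) + t * Complex.I).re = 1 + 1 / Real.log x := by
        rw [Complex.add_re, Complex.ofReal_re]; simp
      have him : (((1 + 1 / Real.log x : ℝ) : ℂ) + t * Complex.I).im = t := by
        rw [Complex.add_im, Complex.ofReal_im]; simp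
      rw [hre, him] at this
      exact this hσ hσ2)
  have heq : ∑ n ∈ Ioc 0 ⌊x⌋₊, LSeries.logMul^[k] vonMangoldtSubOne n * ((1 - n / x : ℝ) : ℂ)
      = ((psiErrorIntegral k x / x : ℝ) : ℂ) := by
    rw [psiErrorIntegral, Finset.sum_div, Complex.ofReal_sum]
    refine Finset.sum_congr rfl fun n _ => ?_
    rw [logMul_iterate_apply, vonMangoldtSubOne, ← Complex.natCast_log]
    have hxC : (x : ℂ) ≠ 0 := by exact_mod_cast hx0.ne'
    push_cast
    field_simp
  rw [heq, Complex.norm_real, Real.norm_eq_abs, abs_div, abs_of_pos hx0, div_le_iff₀ hx0, hxσ] at h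
  calc _ ≤ _ := h
    _ = C * Real.exp 1 * J * x ^ 2 := by ring
    _ ≤ _ := by
      gcongr
      exact le_abs_self _

lemma sum_Ioc_zero_floor_sub {D : ℕ → ℝ} {x y : ℝ} (hxy : x ≤ y) :
    ∑ n ∈ Ioc 0 ⌊y⌋₊, D n = ∑ n ∈ Ioc 0 ⌊x⌋₊, D n + ∑ n ∈ Ioc ⌊x⌋₊ ⌊y⌋₊, D n := by
  have h : ⌊x⌋₊ ≤ ⌊y⌋₊ := Nat.floor_mono hxy
  rw [← Finset.sum_union (Finset.disjoint_left.2 fun n h1 h2 => by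
    simp only [Finset.mem_Ioc] at h1 h2; lia)]
  congr 1
  ext n
  simp only [Finset.mem_Ioc, Finset.mem_union]
  lia

lemma neg_sum_Ioc_floor_mul_le {D w : ℕ → ℝ} {x h L : ℝ} (hx : 0 ≤ x) (hh : 0 ≤ h)
    (hL : 0 ≤ L) (hD : ∀ n : ℕ, x < n → (n : ℝ) ≤ x + h → -L ≤ D n)
    (hw : ∀ n : ℕ, x < n → (n : ℝ) ≤ x + h → 0 ≤ w n ∧ w n ≤ h) :
    -(h * (h + 1) * L) ≤ ∑ n ∈ Ioc ⌊x⌋₊ ⌊x + h⌋₊, D n * w n := by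
  have hcard : ((#(Ioc ⌊x⌋₊ ⌊x + h⌋₊) : ℕ) : ℝ) ≤ h + 1 := by
    rw [Nat.card_Ioc, Nat.cast_sub (Nat.floor_mono (by linarith))]
    have h1 := Nat.floor_le (by positivity : 0 ≤ x + h)
    have h2 := Nat.lt_floor_add_one x
    linarith
  have h1 : #(Ioc ⌊x⌋₊ ⌊x + h⌋₊) • (-(L * h)) ≤ ∑ n ∈ Ioc ⌊x⌋₊ ⌊x + h⌋₊, D n * w n := by
    refine Finset.card_nsmul_le_sum _ _ _ fun n hn => ?_
    rw [Finset.mem_Ioc, Nat.floor_lt hx, Nat.le_floor_iff (by positivity)] at hn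
    have h3 := hD n hn.1 hn.2
    have h4 := hw n hn.1 hn.2
    nlinarith
  refine le_trans ?_ h1
  rw [nsmul_eq_mul]
  have : 0 ≤ L * h := by positivity
  nlinarith

/-- A summatory function is controlled by its integral when the coefficients are bounded
below. -/
lemma mul_abs_sum_le_of_neg_le {D : ℕ → ℝ} {x h L M : ℝ} (hh : 0 ≤ h) (hhx : h ≤ x)
    (hL : 0 ≤ L) (hD : ∀ n : ℕ, (n : ℝ) ≤ x + h → 0 < n → -L ≤ D n)
    (hM : ∀ u : ℝ, x - h ≤ u → u ≤ x + h → |∑ n ∈ Ioc 0 ⌊u⌋₊, D n * (u - n)| ≤ M) :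
    h * |∑ n ∈ Ioc 0 ⌊x⌋₊, D n| ≤ 2 * M + h * (h + 1) * L := by
  have hx : 0 ≤ x := hh.trans hhx
  have m0 := abs_le.1 (hM (x - h) le_rfl (by linarith))
  have m1 := abs_le.1 (hM x (by linarith) (by linarith))
  have m2 := abs_le.1 (hM (x + h) (by linarith) le_rfl)
  have up := neg_sum_Ioc_floor_mul_le (D := D) (w := fun n => x + h - n) hx hh hL
    (fun n h1 h2 => hD n h2 (by
      have : (0 : ℝ) < n := by linarith
      exact_mod_cast this)) (fun n h1 h2 => ⟨by linarith, by linarith⟩)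
  have lo := neg_sum_Ioc_floor_mul_le (D := D) (w := fun n => n - x + h) (x := x - h) (h := h)
    (by linarith) hh hL
    (fun n h1 h2 => hD n (by linarith) (by
      have : (0 : ℝ) < n := by linarith
      exact_mod_cast this)) (fun n h1 h2 => ⟨by linarith, by linarith⟩)
  rw [sub_add_cancel] at lo
  have e1 : ∑ n ∈ Ioc 0 ⌊x + h⌋₊, D n * (x + h - n)
      = ∑ n ∈ Ioc 0 ⌊x⌋₊, D n * (x - n) + h * ∑ n ∈ Ioc 0 ⌊x⌋₊, D n
        + ∑ n ∈ Ioc ⌊x⌋₊ ⌊x + h⌋₊, D n * (x + h - n) := by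
    rw [sum_Ioc_zero_floor_sub (x := x) (by linarith), Finset.mul_sum, ← Finset.sum_add_distrib]
    congr 1
    exact Finset.sum_congr rfl fun n _ => by ring
  have e2 : h * ∑ n ∈ Ioc 0 ⌊x⌋₊, D n = ∑ n ∈ Ioc 0 ⌊x⌋₊, D n * (x - n)
      - ∑ n ∈ Ioc 0 ⌊x - h⌋₊, D n * (x - h - n)
      + ∑ n ∈ Ioc ⌊x - h⌋₊ ⌊x⌋₊, D n * (n - x + h) := by
    rw [sum_Ioc_zero_floor_sub (x := x - h) (y := x) (by linarith),
      sum_Ioc_zero_floor_sub (x := x - h) (y := x) (by linarith), mul_add, Finset.mul_sum,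
      Finset.mul_sum]
    have a1 : ∑ n ∈ Ioc 0 ⌊x - h⌋₊, h * D n = ∑ n ∈ Ioc 0 ⌊x - h⌋₊, D n * (x - n)
        - ∑ n ∈ Ioc 0 ⌊x - h⌋₊, D n * (x - h - n) := by
      rw [← Finset.sum_sub_distrib]
      exact Finset.sum_congr rfl fun n _ => by ring
    have a2 : ∑ n ∈ Ioc ⌊x - h⌋₊ ⌊x⌋₊, h * D n = ∑ n ∈ Ioc ⌊x - h⌋₊ ⌊x⌋₊, D n * (x - n)
        + ∑ n ∈ Ioc ⌊x - h⌋₊ ⌊x⌋₊, D n * (n - x + h) := by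
      rw [← Finset.sum_add_distrib]
      exact Finset.sum_congr rfl fun n _ => by ring
    rw [a1, a2]
    ring
  rw [← abs_of_nonneg hh, ← abs_mul, abs_of_nonneg hh]
  rw [abs_le]
  constructor <;> linarith

lemma exists_abs_psiError_le {m : ℕ} (hm : m ≠ 0) :
    ∃ C : ℝ, 0 ≤ C ∧ ∀ x : ℝ, Real.exp 2 ≤ x →
      |psiError (2 * m) x| ≤ C * (x * Real.log x ^ m) := by
  obtain ⟨C, hC0, hC⟩ := exists_abs_psiErrorIntegral_le (2 * m)
  refine ⟨8 * C + (m.factorial + 1) * 4 ^ m, by positivity, fun x hx => ?_⟩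
  have hx0 : 0 < x := (Real.exp_pos _).trans_le hx
  have hl : 2 ≤ Real.log x := by rwa [Real.le_log_iff_exp_le hx0]
  set l := Real.log x with hldef
  have hl0 : 0 < l := by linarith
  have hlm : 2 ≤ l ^ m := hl.trans (le_self_pow₀ (by linarith) hm)
  have hlm0 : 0 < l ^ m := by linarith
  set h := x / l ^ m with hh
  have hh0 : 0 < h := by positivity
  have hhl : h * l ^ m = x := div_mul_cancel₀ _ hlm0.ne'
  have hhx : h ≤ x / 2 := by
    rw [hh]; gcongr
  have he : Real.exp 1 ≤ x / 2 := by
    have h1 : Real.exp 2 = Real.exp 1 * Real.exp 1 := by rw [← Real.exp_add]; norm_num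
    have h2 : 2 ≤ Real.exp 1 := by have := Real.add_one_le_exp 1; linarith
    nlinarith
  have hL : Real.log (2 * x) ≤ 2 * l := by
    rw [Real.log_mul (by norm_num) hx0.ne']
    have := Real.log_two_lt_d9
    linarith
  have key := mul_abs_sum_le_of_neg_le (x := x) (h := h) (L := (2 * l) ^ (2 * m))
    (M := C * (2 * x) ^ 2)
    (D := fun n => (ArithmeticFunction.vonMangoldt n - 1) * Real.log n ^ (2 * m)) hh0.le
    (by linarith) (by positivity)
    (fun n hn hn0 => by
      have hn1 : (1 : ℝ) ≤ n := by exact_mod_cast hn0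
      have h1 : Real.log n ≤ 2 * l := (Real.log_le_log (by linarith) (by linarith)).trans hL
      have h2 : Real.log n ^ (2 * m) ≤ (2 * l) ^ (2 * m) :=
        pow_le_pow_left₀ (Real.log_nonneg hn1) h1 _
      have h3 : 0 ≤ Real.log n ^ (2 * m) := pow_nonneg (Real.log_nonneg hn1) _
      have h4 : 0 ≤ ArithmeticFunction.vonMangoldt n := ArithmeticFunction.vonMangoldt_nonneg
      nlinarith [mul_nonneg h4 h3])
    (fun u h1 h2 => by
      refine (hC u (by linarith)).trans ?_
      have : 0 ≤ u := by linarith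
      gcongr
      linarith)
  have hfac : l ^ m ≤ m.factorial * x := by
    have := Real.pow_div_factorial_le_exp l hl0.le m
    rw [hldef, Real.exp_log hx0, div_le_iff₀ (by positivity)] at this
    linarith
  have hh1 : h + 1 ≤ (m.factorial + 1) * h := by
    have : 1 ≤ m.factorial * h := by
      rw [hh, ← mul_div_assoc, le_div_iff₀ hlm0]
      linarith
    linarith
  change h * |psiError (2 * m) x| ≤ _ at key
  refine le_of_mul_le_mul_left (key.trans ?_) hh0
  have e1 : 2 * (C * (2 * x) ^ 2) = h * (8 * C * (x * l ^ m)) := by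
    calc 2 * (C * (2 * x) ^ 2) = 8 * C * x * x := by ring
      _ = 8 * C * x * (h * l ^ m) := by rw [hhl]
      _ = _ := by ring
  have e2 : (2 * l) ^ (2 * m) = 4 ^ m * l ^ m * l ^ m := by
    rw [mul_pow, pow_mul, pow_mul, sq l, mul_pow]
    norm_num
    ring
  have e3 : h * (h + 1) * (2 * l) ^ (2 * m)
      ≤ h * ((m.factorial + 1) * h) * (4 ^ m * l ^ m * l ^ m) := by
    rw [e2]; gcongr
  have e4 : h * ((m.factorial + 1) * h) * (4 ^ m * l ^ m * l ^ m)
      = h * ((m.factorial + 1) * 4 ^ m * (x * l ^ m)) := by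
    rw [← hhl]; ring
  rw [e4] at e3
  rw [add_mul, mul_add]
  linarith

lemma hasDerivAt_inv_log_pow {n : ℕ} {t : ℝ} (ht : 1 < t) :
    HasDerivAt (fun t => (Real.log t ^ n)⁻¹) (-(n / (t * Real.log t ^ (n + 1)))) t := by
  have hl : 0 < Real.log t := Real.log_pos ht
  have ht0 : t ≠ 0 := by linarith
  have h := ((Real.hasDerivAt_log ht0).pow n).inv (pow_ne_zero n hl.ne')
  refine h.congr_deriv ?_
  rcases n with - | n
  · simp
  · simp only [Pi.pow_apply, Nat.add_sub_cancel]
    field_simp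
    ring

lemma psiError_zero_eq (x : ℝ) : psiError 0 x = Chebyshev.psi x - ⌊x⌋₊ := by
  simp [psiError, Chebyshev.psi]

lemma abs_psiError_zero_le {x : ℝ} (hx : 1 ≤ x) :
    |psiError 0 x| ≤ x * (Real.log x + 1) := by
  have hl : 0 ≤ Real.log x := Real.log_nonneg hx
  calc |psiError 0 x| ≤ ∑ n ∈ Ioc 0 ⌊x⌋₊, (Real.log x + 1) := by
        refine (Finset.abs_sum_le_sum_abs _ _).trans (Finset.sum_le_sum fun n hn => ?_)
        rw [Finset.mem_Ioc, Nat.le_floor_iff (by linarith)] at hn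
        have hn1 : (1 : ℝ) ≤ n := by exact_mod_cast hn.1
        have h1 : 0 ≤ ArithmeticFunction.vonMangoldt n := ArithmeticFunction.vonMangoldt_nonneg
        have h2 : ArithmeticFunction.vonMangoldt n ≤ Real.log n :=
          ArithmeticFunction.vonMangoldt_le_log
        have h3 := Real.log_le_log (by linarith) hn.2
        rw [pow_zero, mul_one, abs_le]
        constructor <;> linarith
    _ = ⌊x⌋₊ * (Real.log x + 1) := by
        rw [Finset.sum_const, nsmul_eq_mul, Nat.card_Ioc, Nat.sub_zero]
    _ ≤ _ := by
        gcongr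
        exact Nat.floor_le (by linarith)

lemma exists_abs_psiError_zero_le {m : ℕ} (hm : m ≠ 0) :
    ∃ C : ℝ, 0 ≤ C ∧ ∀ x : ℝ, Real.exp 4 ≤ x →
      |psiError 0 x| ≤ C * (x / Real.log x ^ m) + (C + 1) * (√x * Real.log x) := by
  obtain ⟨C, hC0, hC⟩ := exists_abs_psiError_le hm
  refine ⟨C + 2 * m * C * 2 ^ (m + 1), by positivity, fun x hx => ?_⟩
  have hx0 : 0 < x := (Real.exp_pos _).trans_le hx
  have hl : 4 ≤ Real.log x := by rwa [Real.le_log_iff_exp_le hx0]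
  set l := Real.log x with hldef
  have hl0 : 0 < l := by linarith
  set b := √x with hb
  have hb0 : 0 < b := Real.sqrt_pos.2 hx0
  have hlb : Real.log b = l / 2 := Real.log_sqrt hx0.le
  have hbe : Real.exp 2 ≤ b := by
    rw [← Real.le_log_iff_exp_le hb0, hlb]; linarith
  have hb1 : 1 < b := lt_of_lt_of_le (by have := Real.add_one_le_exp (2 : ℝ); linarith) hbe
  have hbx : b ≤ x := by
    have : b * b = x := Real.mul_self_sqrt hx0.le
    nlinarith
  have hlog : ∀ t ∈ Set.Icc b x, l / 2 ≤ Real.log t := fun t ht => by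
    rw [← hlb]; exact Real.log_le_log hb0 ht.1
  have hder : ∀ t ∈ Set.Icc b x, HasDerivAt (fun t => (Real.log t ^ (2 * m))⁻¹)
      (-((2 * m : ℕ) / (t * Real.log t ^ (2 * m + 1)))) t := fun t ht =>
    hasDerivAt_inv_log_pow (hb1.trans_le ht.1)
  have hderint : MeasureTheory.IntegrableOn (deriv fun t => (Real.log t ^ (2 * m))⁻¹)
      (Set.Icc b x) := by
    refine ContinuousOn.integrableOn_Icc (ContinuousOn.congr (f := fun t : ℝ =>
      -((2 * m : ℕ) / (t * Real.log t ^ (2 * m + 1)))) ?_ fun t ht => (hder t ht).deriv)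
    refine (ContinuousOn.div continuousOn_const (continuousOn_id.mul ((Real.continuousOn_log.mono
      fun t ht => ?_).pow _)) fun t ht => ?_).neg
    · exact ne_of_gt (hb0.trans_le ht.1)
    · have h1 : 0 < t := hb0.trans_le ht.1
      have h2 := hlog t ht
      have h3 : 0 < Real.log t := by linarith
      exact (mul_pos h1 (pow_pos h3 _)).ne'
  set D : ℕ → ℝ := fun n => (ArithmeticFunction.vonMangoldt n - 1) * Real.log n ^ (2 * m) with hD
  have hS : ∀ t : ℝ, ∑ n ∈ Icc 0 ⌊t⌋₊, D n = psiError (2 * m) t := fun t => by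
    rw [← Finset.Ioc_insert_left (Nat.zero_le _), Finset.sum_insert (by simp)]
    simp [hD, hm, psiError]
  have habel := sum_mul_eq_sub_sub_integral_mul D hb0.le hbx
    (fun t ht => (hder t ht).differentiableAt) hderint
  simp only [hS] at habel
  have hsum : psiError 0 x = psiError 0 b
      + ∑ n ∈ Ioc ⌊b⌋₊ ⌊x⌋₊, (Real.log n ^ (2 * m))⁻¹ * D n := by
    rw [psiError, sum_Ioc_zero_floor_sub hbx]
    congr 1
    refine Finset.sum_congr rfl fun n hn => ?_
    rw [Finset.mem_Ioc, Nat.floor_lt hb0.le] at hn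
    have : Real.log n ≠ 0 := (Real.log_pos (hb1.trans hn.1)).ne'
    simp only [hD]
    field_simp
  have hbd : ∀ t ∈ Set.Icc b x, |psiError (2 * m) t| ≤ C * (t * Real.log t ^ m) := fun t ht =>
    hC t (hbe.trans ht.1)
  have hend : ∀ t ∈ Set.Icc b x, |(Real.log t ^ (2 * m))⁻¹ * psiError (2 * m) t|
      ≤ C * (t / Real.log t ^ m) := fun t ht => by
    have h3 : 0 < Real.log t := by have := hlog t ht; linarith
    rw [abs_mul, abs_of_pos (by positivity)]
    calc _ ≤ (Real.log t ^ (2 * m))⁻¹ * (C * (t * Real.log t ^ m)) := by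
          gcongr; exact hbd t ht
      _ = _ := by rw [two_mul, pow_add]; field_simp
  have hI : |∫ t in Set.Ioc b x, deriv (fun t => (Real.log t ^ (2 * m))⁻¹) t * psiError (2 * m) t|
      ≤ 2 * m * C * 2 ^ (m + 1) * (x / l ^ m) := by
    have := MeasureTheory.norm_setIntegral_le_of_norm_le_const (μ := MeasureTheory.volume)
      (s := Set.Ioc b x) (C := 2 * m * C * 2 ^ (m + 1) / l ^ m)
      (f := fun t => deriv (fun t => (Real.log t ^ (2 * m))⁻¹) t * psiError (2 * m) t)
      (by simp) (fun t ht => by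
        have ht' := Set.Ioc_subset_Icc_self ht
        have h2 := hlog t ht'
        have h3 : 0 < Real.log t := by linarith
        have ht0 : 0 < t := hb0.trans_le ht'.1
        rw [(hder t ht').deriv, norm_mul, norm_neg, Real.norm_eq_abs, Real.norm_eq_abs,
          abs_of_nonneg (by positivity)]
        calc _ ≤ ((2 * m : ℕ) / (t * Real.log t ^ (2 * m + 1))) * (C * (t * Real.log t ^ m)) := by
              gcongr; exact hbd t ht'
          _ = 2 * m * C / Real.log t ^ (m + 1) := by
              push_cast
              rw [show 2 * m + 1 = m + (m + 1) by ring, pow_add]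
              field_simp
          _ ≤ 2 * m * C / (l / 2) ^ (m + 1) := by gcongr
          _ = 2 * m * C * 2 ^ (m + 1) / l ^ (m + 1) := by rw [div_pow]; field_simp
          _ ≤ _ := by
              gcongr
              · linarith
              · lia)
    rw [Real.norm_eq_abs] at this
    refine this.trans ?_
    rw [MeasureTheory.measureReal_def, Real.volume_Ioc, ENNReal.toReal_ofReal (by linarith)]
    calc _ ≤ 2 * m * C * 2 ^ (m + 1) / l ^ m * x := by gcongr; linarith
      _ = _ := by ring
  have h0 := abs_psiError_zero_le hb1.le
  have hEx := hend x ⟨hbx, le_rfl⟩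
  have hEb := hend b ⟨le_rfl, hbx⟩
  rw [hlb] at h0 hEb
  have hb2 : b / (l / 2) ^ m ≤ b * l := by
    have h1 : 1 ≤ (l / 2) ^ m := one_le_pow₀ (by linarith)
    exact (div_le_self hb0.le h1).trans (le_mul_of_one_le_right hb0.le (by linarith))
  have hb3 : b * (l / 2 + 1) ≤ b * l := by gcongr; linarith
  have hCb : C * (b / (l / 2) ^ m) ≤ C * (b * l) := by gcongr
  have hrest : 0 ≤ 2 * m * C * 2 ^ (m + 1) * (b * l) := by positivity
  rw [← hldef] at hEx
  rw [hsum, habel, hlb, ← hldef]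
  rw [abs_le] at *
  constructor <;> linarith [hI.1, hI.2, hEx.1, hEx.2, hEb.1, hEb.2, h0.1, h0.2]

lemma sqrt_mul_log_le (m : ℕ) {x : ℝ} (hx : 1 < x) :
    √x * Real.log x ≤ 2 ^ (m + 1) * (m + 1).factorial * (x / Real.log x ^ m) := by
  have hx0 : 0 < x := by linarith
  have hl : 0 < Real.log x := Real.log_pos hx
  have hb : √x = Real.exp (Real.log x / 2) := by
    rw [← Real.log_sqrt hx0.le, Real.exp_log (Real.sqrt_pos.2 hx0)]
  have h := Real.pow_div_factorial_le_exp (Real.log x / 2) (by positivity) (m + 1)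
  rw [← hb, div_pow, div_div, div_le_iff₀ (by positivity)] at h
  rw [← mul_div_assoc, le_div_iff₀ (by positivity)]
  calc √x * Real.log x * Real.log x ^ m = √x * Real.log x ^ (m + 1) := by ring
    _ ≤ √x * (√x * (2 ^ (m + 1) * (m + 1).factorial)) := by gcongr
    _ = 2 ^ (m + 1) * (m + 1).factorial * (√x * √x) := by ring
    _ = _ := by rw [Real.mul_self_sqrt hx0.le]

/-- The prime number theorem with error term `O(x / (log x) ^ A)`. -/
theorem exists_abs_theta_sub_le {A : ℝ} (hA : 0 < A) :
    ∃ C : ℝ, 0 ≤ C ∧ ∀ x : ℝ, 3 / 2 ≤ x →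
      |Chebyshev.theta x - x| ≤ C * (x / Real.log x ^ A) := by
  have hm : ⌈A⌉₊ ≠ 0 := (Nat.ceil_pos.2 hA).ne'
  have hAm : A ≤ ⌈A⌉₊ := Nat.le_ceil A
  set m := ⌈A⌉₊
  obtain ⟨C, hC0, hC⟩ := exists_abs_psiError_zero_le hm
  set K : ℝ := 2 ^ (m + 1) * (m + 1).factorial with hK
  have hK0 : 0 ≤ K := by positivity
  refine ⟨C + (C + 4) * K + 2 * 4 ^ A, by positivity, fun x hx => ?_⟩
  have hx0 : 0 < x := by linarith
  have hl0 : 0 < Real.log x := Real.log_pos (by linarith)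
  have hlA : 0 < Real.log x ^ A := Real.rpow_pos_of_pos hl0 _
  have hq : 0 ≤ x / Real.log x ^ A := by positivity
  rcases le_total (Real.exp 4) x with h | h
  · have hl : 4 ≤ Real.log x := by rwa [Real.le_log_iff_exp_le hx0]
    have h1 := hC x h
    have h2 := Chebyshev.abs_psi_sub_theta_le_sqrt_mul_log (x := x) (by linarith)
    have h3 := sqrt_mul_log_le m (x := x) (by linarith)
    have h4 : 1 ≤ √x * Real.log x := by
      have : 1 ≤ √x := Real.one_le_sqrt.2 (by linarith)
      nlinarith
    have h5 : x / Real.log x ^ m ≤ x / Real.log x ^ A := by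
      gcongr
      rw [← Real.rpow_natCast]
      exact Real.rpow_le_rpow_of_exponent_le (by linarith) hAm
    have h6 := Nat.floor_le hx0.le
    have h7 := Nat.lt_floor_add_one x
    rw [psiError_zero_eq] at h1
    have h8 : |Chebyshev.theta x - x|
        ≤ C * (x / Real.log x ^ m) + (C + 4) * (√x * Real.log x) := by
      rw [abs_le] at *
      constructor <;> linarith [h1.1, h1.2, h2.1, h2.2]
    calc _ ≤ _ := h8
      _ ≤ C * (x / Real.log x ^ m) + (C + 4) * (K * (x / Real.log x ^ m)) := by gcongr
      _ = (C + (C + 4) * K) * (x / Real.log x ^ m) := by ring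
      _ ≤ (C + (C + 4) * K) * (x / Real.log x ^ A) := by gcongr
      _ ≤ _ := by
        refine mul_le_mul_of_nonneg_right ?_ hq
        exact le_add_of_nonneg_right (by positivity)
  · have hl : Real.log x ≤ 4 := by rwa [Real.log_le_iff_le_exp hx0]
    have h1 := Chebyshev.theta_le_log4_mul_x hx0.le
    have h2 := Chebyshev.theta_nonneg x
    have h3 : Real.log 4 ≤ 2 := by
      rw [show (4 : ℝ) = 2 ^ 2 by norm_num, Real.log_pow]
      have := Real.log_two_lt_d9
      push_cast
      linarith
    have h4 : |Chebyshev.theta x - x| ≤ 2 * x := by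
      rw [abs_le]
      constructor <;> nlinarith
    have h5 : Real.log x ^ A ≤ 4 ^ A := Real.rpow_le_rpow hl0.le hl hA.le
    calc _ ≤ 2 * x := h4
      _ = 2 * Real.log x ^ A * (x / Real.log x ^ A) := by field_simp
      _ ≤ 2 * 4 ^ A * (x / Real.log x ^ A) := by gcongr
      _ ≤ _ := by
        refine mul_le_mul_of_nonneg_right ?_ hq
        exact le_add_of_nonneg_left (by positivity)

/-- Partial summation over primes, with main term the integral of the weight. -/
lemma sum_primes_mul_log_sub_integral_eq {g : ℝ → ℝ} {y x B : ℝ} (hy : 0 ≤ y) (hyx : y ≤ x)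
    (hg : ∀ t ∈ Set.Icc y x, DifferentiableAt ℝ g t)
    (hB : ∀ t ∈ Set.Icc y x, |deriv g t| ≤ B) :
    ∑ p ∈ Ioc ⌊y⌋₊ ⌊x⌋₊ with p.Prime, g p * Real.log p - ∫ t in y..x, g t
      = g x * (Chebyshev.theta x - x) - g y * (Chebyshev.theta y - y)
        - ∫ t in y..x, deriv g t * (Chebyshev.theta t - t) := by
  have hderint : MeasureTheory.IntegrableOn (deriv g) (Set.Icc y x) :=
    MeasureTheory.Measure.integrableOn_of_bounded (M := B) (by simp)
      (measurable_deriv g).aestronglyMeasurable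
      ((MeasureTheory.ae_restrict_iff' measurableSet_Icc).2 (Eventually.of_forall hB))
  have hintE : MeasureTheory.IntegrableOn (fun t => deriv g t * Chebyshev.theta t)
      (Set.Icc y x) := by
    refine MeasureTheory.Measure.integrableOn_of_bounded (M := B * Chebyshev.theta x) (by simp)
      ((measurable_deriv g).mul Chebyshev.theta_mono.measurable).aestronglyMeasurable
      ((MeasureTheory.ae_restrict_iff' measurableSet_Icc).2 (Eventually.of_forall fun t ht => ?_))
    rw [norm_mul, Real.norm_eq_abs, Real.norm_eq_abs, abs_of_nonneg (Chebyshev.theta_nonneg t)]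
    exact mul_le_mul (hB t ht) (Chebyshev.theta_mono ht.2) (Chebyshev.theta_nonneg t)
      ((abs_nonneg _).trans (hB t ht))
  have habel := sum_mul_eq_sub_sub_integral_mul (fun n : ℕ => if n.Prime then Real.log n else 0)
    hy hyx hg hderint
  simp only [← Finset.sum_filter, ← Chebyshev.theta_eq_sum_Icc] at habel
  have hsum : ∑ p ∈ Ioc ⌊y⌋₊ ⌊x⌋₊ with p.Prime, g p * Real.log p
      = ∑ n ∈ Ioc ⌊y⌋₊ ⌊x⌋₊, g n * (if n.Prime then Real.log n else 0) := by
    rw [Finset.sum_filter]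
    exact Finset.sum_congr rfl fun n _ => by split_ifs <;> simp
  have hinti : IntervalIntegrable (deriv g) MeasureTheory.volume y x :=
    (intervalIntegrable_iff_integrableOn_Icc_of_le hyx).2 hderint
  have hintEi : IntervalIntegrable (fun t => deriv g t * Chebyshev.theta t)
      MeasureTheory.volume y x := (intervalIntegrable_iff_integrableOn_Icc_of_le hyx).2 hintE
  have hintt : IntervalIntegrable (fun t => deriv g t * t) MeasureTheory.volume y x :=
    hinti.mul_continuousOn continuousOn_id
  have hgc : IntervalIntegrable g MeasureTheory.volume y x := by
    refine ContinuousOn.intervalIntegrable ?_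
    rw [Set.uIcc_of_le hyx]
    exact fun t ht => (hg t ht).continuousAt.continuousWithinAt
  have hparts : ∫ t in y..x, (deriv g t * t + g t) = g x * x - g y * y := by
    refine intervalIntegral.integral_eq_sub_of_hasDerivAt (f := fun t => g t * t)
      (fun t ht => ?_) (hintt.add hgc)
    rw [Set.uIcc_of_le hyx] at ht
    simpa using! (hg t ht).hasDerivAt.mul (hasDerivAt_id t)
  rw [intervalIntegral.integral_add hintt hgc] at hparts
  simp only [mul_sub]
  rw [intervalIntegral.integral_sub hintEi hintt, hsum, habel,
    intervalIntegral.integral_of_le hyx (f := fun t => deriv g t * Chebyshev.theta t)]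
  linarith

lemma filter_Icc_two_floor_eq {y x : ℝ} (hy : 0 ≤ y) :
    (Finset.Icc 2 ⌊x⌋₊).filter (fun p : ℕ => p.Prime ∧ y < (p : ℝ))
      = (Ioc ⌊y⌋₊ ⌊x⌋₊).filter Nat.Prime := by
  ext p
  simp only [Finset.mem_filter, Finset.mem_Icc, Finset.mem_Ioc, Nat.floor_lt hy]
  constructor
  · rintro ⟨⟨_, h1⟩, h2, h3⟩
    exact ⟨⟨h3, h1⟩, h2⟩
  · rintro ⟨⟨h3, h1⟩, h2⟩
    exact ⟨⟨h2.two_le, h1⟩, h2, h3⟩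

/-- Jia's Lemma 3, case `c < -1`: if `f` is differentiable on `[1, ∞)` with
`f(x) = O(x^c)` and `f'(x) = O(x^{c-1})`, then for every `A > 0` there is a constant `M`
such that for all `3/2 < y ≤ x`,
`Σ_{y < p ≤ x} f(p) = ∫_y^x f(t)/log t dt + O(y^{c+1}/(log y)^A)`. -/
theorem prime_sum_asymptotic_small_exponent
    (c : ℝ) (hc : c < -1) (f : ℝ → ℝ)
    (hdiff : ∀ x : ℝ, 1 ≤ x → DifferentiableAt ℝ f x)
    (K : ℝ) (hf : ∀ x : ℝ, 1 ≤ x → |f x| ≤ K * x ^ c)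
    (hf' : ∀ x : ℝ, 1 ≤ x → |deriv f x| ≤ K * x ^ (c - 1))
    (A : ℝ) (hA : 0 < A) :
    ∃ M : ℝ, ∀ y x : ℝ, 3 / 2 < y → y ≤ x →
      |(∑ p ∈ (Finset.Icc 2 ⌊x⌋₊).filter (fun p : ℕ => p.Prime ∧ y < (p : ℝ)),
          f (p : ℝ))
        - ∫ t in y..x, f t / Real.log t| ≤ M * (y ^ (c + 1) / Real.log y ^ A) := by
  obtain ⟨C, hC0, hC⟩ := exists_abs_theta_sub_le hA
  have hK : 0 ≤ K := by simpa using (abs_nonneg _).trans (hf 1 le_rfl)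
  set l : ℝ := Real.log (3 / 2) with hl
  have hl0 : 0 < l := Real.log_pos (by norm_num)
  set K₂ : ℝ := K / l + K / l ^ 2 with hK₂
  have hK₂0 : 0 ≤ K₂ := by positivity
  have hc1 : 0 < -(c + 1) := by linarith
  refine ⟨2 * (K / l * C) + K₂ * C / (-(c + 1)), fun y x hy hyx => ?_⟩
  have hy0 : 0 < y := by linarith
  have hly : 0 < Real.log y := Real.log_pos (by linarith)
  set L := Real.log y ^ A with hL
  have hL0 : 0 < L := Real.rpow_pos_of_pos hly A
  set g : ℝ → ℝ := fun t => f t / Real.log t with hgdef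
  have hlt : ∀ t ∈ Set.Icc y x, l ≤ Real.log t := fun t ht =>
    Real.log_le_log (by norm_num) (by linarith [ht.1])
  have hder : ∀ t ∈ Set.Icc y x,
      HasDerivAt g (deriv f t / Real.log t - f t * t⁻¹ / Real.log t ^ 2) t := fun t ht => by
    have h0 : 0 < Real.log t := hl0.trans_le (hlt t ht)
    have ht0 : t ≠ 0 := by have := ht.1; linarith
    refine ((hdiff t (by linarith [ht.1])).hasDerivAt.div (Real.hasDerivAt_log ht0)
      h0.ne').congr_deriv ?_
    field_simp
  have hgb : ∀ t ∈ Set.Icc y x, |g t| ≤ K / l * t ^ c := fun t ht => by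
    have h0 : 0 < Real.log t := hl0.trans_le (hlt t ht)
    have ht0 : 0 < t := hy0.trans_le ht.1
    rw [hgdef, abs_div, abs_of_pos h0]
    calc _ ≤ K * t ^ c / l := by
          gcongr
          · exact hf t (by linarith [ht.1])
          · exact hlt t ht
      _ = _ := by ring
  have hg'b : ∀ t ∈ Set.Icc y x, |deriv g t| ≤ K₂ * t ^ (c - 1) := fun t ht => by
    have h0 : 0 < Real.log t := hl0.trans_le (hlt t ht)
    have ht0 : 0 < t := hy0.trans_le ht.1
    have hle := hlt t ht
    rw [(hder t ht).deriv]
    refine (abs_sub _ _).trans ?_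
    rw [abs_div, abs_div, abs_mul, abs_of_pos h0, abs_of_pos (inv_pos.2 ht0),
      abs_of_pos (by positivity : 0 < Real.log t ^ 2)]
    calc _ ≤ K * t ^ (c - 1) / l + K * t ^ c * t⁻¹ / l ^ 2 := by
          gcongr
          · exact hf' t (by linarith [ht.1])
          · exact hf t (by linarith [ht.1])
      _ = _ := by
          rw [Real.rpow_sub_one ht0.ne', hK₂]
          field_simp
  have hE : ∀ t ∈ Set.Icc y x, |Chebyshev.theta t - t| ≤ C * (t / L) := fun t ht => by
    have ht0 : 0 < t := hy0.trans_le ht.1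
    refine (hC t (by linarith [ht.1])).trans ?_
    gcongr
    exact Real.rpow_le_rpow hly.le (Real.log_le_log hy0 ht.1) hA.le
  have hpow : ∀ t : ℝ, 0 < t → t ^ c * t = t ^ (c + 1) := fun t ht =>
    (Real.rpow_add_one ht.ne' c).symm
  have hend : ∀ t ∈ Set.Icc y x,
      |g t * (Chebyshev.theta t - t)| ≤ K / l * C * (y ^ (c + 1) / L) := fun t ht => by
    have ht0 : 0 < t := hy0.trans_le ht.1
    rw [abs_mul]
    calc _ ≤ K / l * t ^ c * (C * (t / L)) :=
          mul_le_mul (hgb t ht) (hE t ht) (abs_nonneg _) (by positivity)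
      _ = K / l * C * (t ^ c * t / L) := by ring
      _ ≤ _ := by
          rw [hpow t ht0]
          exact mul_le_mul_of_nonneg_left (div_le_div_of_nonneg_right
            (Real.rpow_le_rpow_of_nonpos hy0 ht.1 (by linarith)) hL0.le) (by positivity)
  have hI : |∫ t in y..x, deriv g t * (Chebyshev.theta t - t)|
      ≤ K₂ * C / (-(c + 1)) * (y ^ (c + 1) / L) := by
    have h0 : (0 : ℝ) ∉ Set.uIcc y x := by
      rw [Set.uIcc_of_le hyx]
      exact fun h => by linarith [h.1]
    have h1 := intervalIntegral.norm_integral_le_of_norm_le (μ := MeasureTheory.volume) hyx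
      (f := fun t => deriv g t * (Chebyshev.theta t - t)) (g := fun t => K₂ * C / L * t ^ c)
      (Eventually.of_forall fun t ht => by
        have ht' := Set.Ioc_subset_Icc_self ht
        have ht0 : 0 < t := hy0.trans_le ht'.1
        rw [norm_mul, Real.norm_eq_abs, Real.norm_eq_abs]
        calc _ ≤ K₂ * t ^ (c - 1) * (C * (t / L)) :=
              mul_le_mul (hg'b t ht') (hE t ht') (abs_nonneg _) (by positivity)
          _ = _ := by
              rw [Real.rpow_sub_one ht0.ne']
              field_simp)
      ((intervalIntegral.intervalIntegrable_rpow (Or.inr h0)).const_mul _)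
    rw [intervalIntegral.integral_const_mul, integral_rpow (Or.inr ⟨hc.ne, h0⟩)] at h1
    refine h1.trans ?_
    have hx1 : 0 ≤ x ^ (c + 1) := Real.rpow_nonneg (by linarith) _
    calc K₂ * C / L * ((x ^ (c + 1) - y ^ (c + 1)) / (c + 1))
        = K₂ * C / L * ((y ^ (c + 1) - x ^ (c + 1)) / (-(c + 1))) := by
          rw [← neg_sub (y ^ (c + 1)), neg_div, div_neg]
      _ ≤ K₂ * C / L * (y ^ (c + 1) / (-(c + 1))) := by
          gcongr
          linarith
      _ = _ := by ring
  have hsum : ∑ p ∈ (Finset.Icc 2 ⌊x⌋₊).filter (fun p : ℕ => p.Prime ∧ y < (p : ℝ)), f (p : ℝ)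
      = ∑ p ∈ Ioc ⌊y⌋₊ ⌊x⌋₊ with p.Prime, g p * Real.log p := by
    rw [filter_Icc_two_floor_eq hy0.le]
    refine Finset.sum_congr rfl fun p hp => ?_
    have : 1 < (p : ℝ) := by exact_mod_cast (Finset.mem_filter.1 hp).2.one_lt
    exact (div_mul_cancel₀ _ (Real.log_pos this).ne').symm
  rw [hsum, sum_primes_mul_log_sub_integral_eq (B := K₂) hy0.le hyx
    (fun t ht => (hder t ht).differentiableAt) fun t ht => (hg'b t ht).trans
      (mul_le_of_le_one_right hK₂0
        (Real.rpow_le_one_of_one_le_of_nonpos (by linarith [ht.1]) (by linarith)))]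
  have h1 := hend x ⟨hyx, le_rfl⟩
  have h2 := hend y ⟨le_rfl, hyx⟩
  rw [add_mul]
  rw [abs_le] at *
  constructor <;> linarith [h1.1, h1.2, h2.1, h2.2, hI.1, hI.2]
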